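/- arXiv:1303.7381 — 4 statements merged into one kernel-verified Lean document; each statement's English description precedes it below -/
import Mathlib

section
/- Let ξ : G → A and suppose that the net of finite partial sums of ∑_{g∈G} ξ(g)λ_Σ(g) converges to some x ∈ C*_r(Σ) with respect to the norm ‖·‖_α (i.e. ‖∑_{g∈F} ξ(g)λ_Σ(g) − x‖_α → 0 as the finite set F increases to G). Then ξ ∈ A^Σ and ξ = x̂. -/
open scoped ComplexOrder

noncomputable section

namespace BCFourier

/-- A twisted (unital, discrete) C*-dynamical system `Σ = (A, G, α, σ)`. -/
structure TwistedSystem (A : Type*) (G : Type*) [CStarAlgebra A] [Group G] where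
  α : G → (A ≃⋆ₐ[ℂ] A)
  σ : G → G → A
  σ_unitary : ∀ g h, σ g h ∈ unitary A
  alpha_mul : ∀ g h a, α g (α h a) = σ g h * α (g * h) a * star (σ g h)
  sigma_cocycle : ∀ g h k, σ g h * σ (g * h) k = α g (σ h k) * σ g (h * k)
  sigma_one_left : ∀ g, σ 1 g = 1
  sigma_one_right : ∀ g, σ g 1 = 1

variable {A G B : Type*} [CStarAlgebra A] [Group G] [CStarAlgebra B]

/-- Membership in the Hilbert `A`-module `A^Σ`:  unconditional norm convergence of
`∑_g α_g⁻¹(ξ(g)* ξ(g))`. -/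
def MemAS (S : TwistedSystem A G) (ξ : G → A) : Prop :=
  Summable fun g => (S.α g).symm (star (ξ g) * ξ g)

/-- The `A`-valued inner product `⟨ξ, η⟩_α = ∑_g α_g⁻¹(ξ(g)* η(g))` on `A^Σ`. -/
def innerAS (S : TwistedSystem A G) (ξ η : G → A) : A :=
  ∑' g, (S.α g).symm (star (ξ g) * η g)

/-- The norm `‖ξ‖_α = ‖⟨ξ,ξ⟩_α‖^{1/2}` on `A^Σ`. -/
def normAS (S : TwistedSystem A G) (ξ : G → A) : ℝ :=
  Real.sqrt ‖innerAS S ξ ξ‖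

/-- Abstract characterization of the reduced twisted crossed product `C*_r(Σ)`:
a C*-algebra `B` together with a copy `ι` of `A`, unitaries `u g` implementing the
twisted action, and the canonical faithful conditional expectation `E`, such that
the Fourier coefficients `x̂(g) = E(x u_g*)` lie in `A^Σ`, `E(x* x) = ⟨x̂, x̂⟩_α`,
and `B` is topologically generated by the elements `ι(a) u g`. -/
structure CrossedProduct {A G : Type*} [CStarAlgebra A] [Group G]
    (S : TwistedSystem A G) (B : Type*) [CStarAlgebra B] where
  ι : A →⋆ₐ[ℂ] B
  ι_isometric : ∀ a, ‖ι a‖ = ‖a‖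
  u : G → B
  u_unitary : ∀ g, u g ∈ unitary B
  u_one : u 1 = 1
  covariance : ∀ g a, u g * ι a = ι (S.α g a) * u g
  u_mul : ∀ g h, u g * u h = ι (S.σ g h) * u (g * h)
  E : B →L[ℂ] A
  E_iota : ∀ a, E (ι a) = a
  E_perp : ∀ a g, g ≠ 1 → E (ι a * u g) = 0
  E_contractive : ∀ x, ‖E x‖ ≤ ‖x‖
  E_faithful : ∀ x, E (star x * x) = 0 → x = 0
  hat_mem : ∀ x : B, MemAS S fun g => E (x * star (u g))
  E_inner : ∀ x : B,
    E (star x * x) = innerAS S (fun g => E (x * star (u g))) fun g => E (x * star (u g))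
  generated : Dense (↑(Submodule.span ℂ {b : B | ∃ a g, b = ι a * u g}) : Set B)

variable {S : TwistedSystem A G}

/-- The Fourier transform `x̂ : G → A` of `x ∈ C*_r(Σ)`. -/
def hatF (D : CrossedProduct S B) (x : B) : G → A := fun g => D.E (x * star (D.u g))

/-- The norm `‖x‖_α = ‖x̂‖_α = ‖E(x* x)‖^{1/2}` on `C*_r(Σ)`. -/
def alphaNorm (D : CrossedProduct S B) (x : B) : ℝ := Real.sqrt ‖D.E (star x * x)‖

/-- `Λ_Σ(f) = ∑_g f(g) λ_Σ(g)` for finitely supported `f : G → A`. -/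
def Lam (D : CrossedProduct S B) (f : G → A) : B := ∑ᶠ g, D.ι (f g) * D.u g

/-- `CF(Σ)`: the set of `x ∈ C*_r(Σ)` whose Fourier series `∑_g x̂(g) λ_Σ(g)`
converges unconditionally in the operator norm. -/
def CFmem (D : CrossedProduct S B) (x : B) : Prop :=
  ∃ y : B, HasSum (fun g => D.ι (hatF D x g) * D.u g) y

/-- `M : C*_r(Σ) → C*_r(Σ)` is the bounded map associated with the (reduced)
multiplier `T : G × A → A`, i.e. `T ∈ MA(Σ)` with `M_T = M`. -/
def IsMultiplier (D : CrossedProduct S B) (T : G → A → A) (M : B →L[ℂ] B) : Prop :=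
  (∀ g, IsLinearMap ℂ (T g)) ∧ ∀ g a, M (D.ι a * D.u g) = D.ι (T g a) * D.u g

/-- The norm of a column vector in the Hilbert `B`-module `Bⁿ`. -/
def vecNorm {n : ℕ} (x : Fin n → B) : ℝ := Real.sqrt ‖∑ i, star (x i) * x i‖

/-- The C*-norm on `Mₙ(B)`, realized as the operator norm for the action of
matrices on the Hilbert `B`-module `Bⁿ`. -/
def matNorm {n : ℕ} (m : Matrix (Fin n) (Fin n) B) : ℝ :=
  sInf {M : ℝ | 0 ≤ M ∧ ∀ x : Fin n → B, vecNorm (m.mulVec x) ≤ M * vecNorm x}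

/-- `φ : B → B` is completely bounded with cb-norm at most `M`. -/
def CBBoundedBy (φ : B → B) (M : ℝ) : Prop :=
  0 ≤ M ∧ ∀ (n : ℕ) (m : Matrix (Fin n) (Fin n) B), matNorm (m.map φ) ≤ M * matNorm m

/-- The completely bounded norm `‖φ‖_cb`. -/
def cbNorm (φ : B → B) : ℝ := sInf {M : ℝ | CBBoundedBy φ M}

/-- `φ : B → B` is completely bounded. -/
def IsCompletelyBounded (φ : B → B) : Prop := ∃ M, CBBoundedBy φ M

/-- `φ : B → B` is completely positive. -/
def IsCompletelyPositive [PartialOrder B] [StarOrderedRing B] (φ : B → B) : Prop :=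
  ∀ (n : ℕ) (b c : Fin n → B), 0 ≤ ∑ i, ∑ j, star (c i) * φ (star (b i) * b j) * c j

/-- `ξ` tends to `0` at infinity w.r.t. the norm `N`. -/
def TendsZeroAtInfty (N : (G → A) → ℝ) (ξ : G → A) : Prop :=
  ∀ ε : ℝ, 0 < ε → ∃ F₀ : Finset G, ∀ F : Finset G, Disjoint F F₀ →
    N (Set.indicator (↑F : Set G) ξ) < ε

/-- The (closed, two-sided) ideal of `C*_r(Σ)` induced by a subset `J` of `A`. -/
def genIdeal (D : CrossedProduct S B) (J : Set A) : Set B :=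
  closure ↑(Submodule.span ℂ {z : B | ∃ x y : B, ∃ j ∈ J, z = x * D.ι j * y})

/-- `J` is an `α`-invariant closed two-sided ideal of `A`. -/
def IsInvIdeal (S : TwistedSystem A G) (J : Set A) : Prop :=
  IsClosed J ∧ (0 : A) ∈ J ∧ (∀ a b, a ∈ J → b ∈ J → a + b ∈ J) ∧
    (∀ a ∈ J, ∀ b : A, b * a ∈ J ∧ a * b ∈ J) ∧ ∀ g, ∀ a ∈ J, S.α g a ∈ J

/-- A closed two-sided ideal of a C*-algebra, as a set. -/
def IsClosedIdeal {B : Type*} [CStarAlgebra B] (I : Set B) : Prop :=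
  IsClosed I ∧ (0 : B) ∈ I ∧ (∀ x y, x ∈ I → y ∈ I → x + y ∈ I) ∧
    ∀ x ∈ I, ∀ b : B, b * x ∈ I ∧ x * b ∈ I

/-- An ideal `I` of `C*_r(Σ)` is `E`-invariant when `E(I) ⊆ I`. -/
def EInv (D : CrossedProduct S B) (I : Set B) : Prop := ∀ x ∈ I, D.ι (D.E x) ∈ I

/-- A Fourier summing net for `Σ`: a net `{Tⁱ}` in `MCF(Σ)` such that
`M_{Tⁱ}(x) → x` in norm for every `x ∈ C*_r(Σ)`. -/
structure FSNet {A G : Type*} [CStarAlgebra A] [Group G] {S : TwistedSystem A G}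
    {B : Type*} [CStarAlgebra B] (D : CrossedProduct S B) where
  Idx : Type
  pre : Preorder Idx
  dir : IsDirected Idx fun a b => pre.le a b
  nonempty : Nonempty Idx
  T : Idx → G → A → A
  T_lin : ∀ i g, IsLinearMap ℂ (T i g)
  M : Idx → B →L[ℂ] B
  M_mult : ∀ i g a, M i (D.ι a * D.u g) = D.ι (T i g a) * D.u g
  M_cf : ∀ i x, CFmem D (M i x)
  M_lim : ∀ x : B, Filter.Tendsto (fun i => ‖M i x - x‖) (@Filter.atTop Idx pre) (nhds 0)

/-- `Σ` has the bounded Fejér property: there is a bounded Fourier summing net for `Σ`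
consisting of multipliers with finite `G`-support. -/
def HasBoundedFejer (D : CrossedProduct S B) : Prop :=
  ∃ net : FSNet D, (∃ C : ℝ, ∀ i, ‖net.M i‖ ≤ C) ∧ ∀ i, {g | ∃ a, net.T i g a ≠ 0}.Finite


/-- A (right) Hilbert `A`-module structure on `X`: right `A`-action `smulA`,
`A`-valued inner product (linear in the second variable), with
`‖x‖ = ‖⟨x,x⟩‖^{1/2}`. -/
structure HilbMod (A : Type*) [CStarAlgebra A] [PartialOrder A] [StarOrderedRing A]
    (X : Type*) [NormedAddCommGroup X] [NormedSpace ℂ X] where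
  smulA : X → A → X
  inner : X → X → A
  smulA_add : ∀ x a b, smulA x (a + b) = smulA x a + smulA x b
  add_smulA : ∀ x y a, smulA (x + y) a = smulA x a + smulA y a
  smulA_mul : ∀ x a b, smulA x (a * b) = smulA (smulA x a) b
  smulA_one : ∀ x, smulA x 1 = x
  smulA_smul : ∀ (c : ℂ) x a, smulA (c • x) a = c • smulA x a
  smul_smulA : ∀ (c : ℂ) x a, smulA x (c • a) = c • smulA x a
  inner_add_right : ∀ x y z, inner x (y + z) = inner x y + inner x z
  inner_smulA_right : ∀ x y a, inner x (smulA y a) = inner x y * a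
  inner_smul_right : ∀ (c : ℂ) x y, inner x (c • y) = c • inner x y
  inner_conj : ∀ x y, star (inner x y) = inner y x
  inner_self_nonneg : ∀ x, 0 ≤ inner x x
  inner_self_eq_zero : ∀ x, inner x x = 0 → x = 0
  norm_eq : ∀ x, ‖x‖ = Real.sqrt ‖inner x x‖

/-- `π` is a representation of `A` by adjointable operators on the Hilbert
`A`-module `X`. -/
def IsRepOn {A X : Type*} [CStarAlgebra A] [PartialOrder A] [StarOrderedRing A]
    [NormedAddCommGroup X] [NormedSpace ℂ X] (hX : HilbMod A X) (π : A → X →L[ℂ] X) : Prop :=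
  π 1 = ContinuousLinearMap.id ℂ X ∧
  (∀ a b x, π (a * b) x = π a (π b x)) ∧
  (∀ a b, π (a + b) = π a + π b) ∧
  (∀ (c : ℂ) a, π (c • a) = c • π a) ∧
  (∀ a x y, hX.inner (π a x) y = hX.inner x (π (star a) y)) ∧
  ∀ a x b, π a (hX.smulA x b) = hX.smulA (π a x) b

/-- An equivariant representation `(ρ, v)` of `Σ` on a Hilbert `A`-module `X`. -/
structure EquivRep {A G : Type*} [CStarAlgebra A] [PartialOrder A] [StarOrderedRing A]
    [Group G] (S : TwistedSystem A G) {X : Type*} [NormedAddCommGroup X] [NormedSpace ℂ X]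
    (hX : HilbMod A X) where
  ρ : A → X →L[ℂ] X
  ρ_rep : IsRepOn hX ρ
  v : G → X ≃L[ℂ] X
  cov : ∀ g a x, ρ (S.α g a) x = v g (ρ a ((v g).symm x))
  v_mul : ∀ g h x, v g (v h x) = hX.smulA (ρ (S.σ g h) (v (g * h) x)) (star (S.σ g h))
  v_inner : ∀ g x y, S.α g (hX.inner x y) = hX.inner (v g x) (v g y)
  v_smulA : ∀ g x a, v g (hX.smulA x a) = hX.smulA (v g x) (S.α g a)

/-- The data of the quotient system `Σ̃ = (A/J, G, α̃, σ̃)`, its reduced crossed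
product, and the canonical map `q̃ : C*_r(Σ) → C*_r(Σ̃)`. -/
structure QuotientData {A G : Type*} [CStarAlgebra A] [Group G] {S : TwistedSystem A G}
    {B : Type*} [CStarAlgebra B] (D : CrossedProduct S B) (J : Set A) where
  Aq : Type
  [algAq : CStarAlgebra Aq]
  Sq : @TwistedSystem Aq G algAq _
  Bq : Type
  [algBq : CStarAlgebra Bq]
  Dq : @CrossedProduct Aq G algAq _ Sq Bq algBq
  q : A → Aq
  q_add : ∀ a b, q (a + b) = q a + q b
  q_mul : ∀ a b, q (a * b) = q a * q b
  q_star : ∀ a, q (star a) = star (q a)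
  q_smul : ∀ (c : ℂ) a, q (c • a) = c • q a
  q_one : q 1 = 1
  q_surj : Function.Surjective q
  q_ker : ∀ a, q a = 0 ↔ a ∈ J
  q_alpha : ∀ g a, q (S.α g a) = Sq.α g (q a)
  q_sigma : ∀ g h, q (S.σ g h) = Sq.σ g h
  Q : B → Bq
  Q_add : ∀ x y, Q (x + y) = Q x + Q y
  Q_smul : ∀ (c : ℂ) x, Q (c • x) = c • Q x
  Q_mul : ∀ x y, Q (x * y) = Q x * Q y
  Q_star : ∀ x, Q (star x) = star (Q x)
  Q_cont : Continuous Q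
  Q_gen : ∀ a g, Q (D.ι a * D.u g) = Dq.ι (q a) * Dq.u g

attribute [instance] QuotientData.algAq QuotientData.algBq

/-- The data of the reduced group C*-algebra `C*_r(G)`, the minimal tensor
product `C*_r(Σ) ⊗ C*_r(G)` and the reduced dual coaction
`δ_Σ : C*_r(Σ) → C*_r(Σ) ⊗ C*_r(G)`, `δ_Σ(a λ_Σ(g)) = a λ_Σ(g) ⊗ λ(g)`,
together with the slice map `id ⊗ τ` satisfying `(id ⊗ τ) ∘ δ_Σ = E`. -/
structure CoactionData {A G : Type*} [CStarAlgebra A] [Group G] {S : TwistedSystem A G}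
    {B : Type*} [CStarAlgebra B] (D : CrossedProduct S B) where
  CG : Type
  [algCG : CStarAlgebra CG]
  lam : G → CG
  lam_unitary : ∀ g, lam g ∈ unitary CG
  lam_mul : ∀ g h, lam (g * h) = lam g * lam h
  lam_gen : Dense (↑(Submodule.span ℂ (Set.range lam)) : Set CG)
  tau : CG →L[ℂ] ℂ
  tau_pos : ∀ c, 0 ≤ tau (star c * c)
  tau_lam_one : tau (lam 1) = 1
  tau_lam_ne : ∀ g, g ≠ 1 → tau (lam g) = 0
  BT : Type
  [algBT : CStarAlgebra BT]
  tens : B → CG → BT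
  tens_add_left : ∀ x y c, tens (x + y) c = tens x c + tens y c
  tens_add_right : ∀ x c d, tens x (c + d) = tens x c + tens x d
  tens_smul_left : ∀ (z : ℂ) x c, tens (z • x) c = z • tens x c
  tens_smul_right : ∀ (z : ℂ) x c, tens x (z • c) = z • tens x c
  tens_mul : ∀ x y c d, tens x c * tens y d = tens (x * y) (c * d)
  tens_star : ∀ x c, star (tens x c) = tens (star x) (star c)
  tens_norm : ∀ x c, ‖tens x c‖ = ‖x‖ * ‖c‖
  tens_gen : Dense (↑(Submodule.span ℂ {z : BT | ∃ x c, z = tens x c}) : Set BT)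
  slice : BT →L[ℂ] B
  slice_tens : ∀ x c, slice (tens x c) = tau c • x
  delta : B → BT
  delta_add : ∀ x y, delta (x + y) = delta x + delta y
  delta_smul : ∀ (z : ℂ) x, delta (z • x) = z • delta x
  delta_mul : ∀ x y, delta (x * y) = delta x * delta y
  delta_star : ∀ x, delta (star x) = star (delta x)
  delta_cont : Continuous delta
  delta_gen : ∀ a g, delta (D.ι a * D.u g) = tens (D.ι a * D.u g) (lam g)
  slice_delta : ∀ x, slice (delta x) = D.ι (D.E x)

attribute [instance] CoactionData.algCG CoactionData.algBT


namespace CrossedProduct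

/-- `λ(g) λ(h)* = σ(gh⁻¹, h)* λ(gh⁻¹)`. -/
lemma u_mul_star_u (D : CrossedProduct S B) (g h : G) :
    D.u g * star (D.u h) = D.ι (star (S.σ (g * h⁻¹) h)) * D.u (g * h⁻¹) := by
  have hmul := D.u_mul (g * h⁻¹) h
  rw [inv_mul_cancel_right] at hmul
  have hu : D.u g = D.ι (star (S.σ (g * h⁻¹) h)) * (D.u (g * h⁻¹) * D.u h) := by
    rw [hmul, ← mul_assoc, ← map_mul, Unitary.star_mul_self_of_mem (S.σ_unitary _ _), map_one,
      one_mul]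
  rw [hu, mul_assoc, mul_assoc, Unitary.mul_star_self_of_mem (D.u_unitary h), mul_one]

lemma hatF_sub (D : CrossedProduct S B) (x y : B) (g : G) :
    hatF D (x - y) g = hatF D x g - hatF D y g := by
  simp only [hatF, sub_mul, map_sub]

lemma hatF_iota_mul_u_self (D : CrossedProduct S B) (a : A) (g : G) :
    hatF D (D.ι a * D.u g) g = a := by
  rw [hatF, mul_assoc, Unitary.mul_star_self_of_mem (D.u_unitary g), mul_one, D.E_iota]

lemma hatF_iota_mul_u_of_ne (D : CrossedProduct S B) (a : A) {g h : G} (hgh : g ≠ h) :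
    hatF D (D.ι a * D.u g) h = 0 := by
  rw [hatF, mul_assoc, D.u_mul_star_u, ← mul_assoc, ← map_mul]
  exact D.E_perp _ _ (mul_inv_eq_one.not.mpr hgh)

lemma hatF_sum_iota_mul_u (D : CrossedProduct S B) (ξ : G → A) {F : Finset G} {h : G}
    (hF : h ∈ F) : hatF D (∑ g ∈ F, D.ι (ξ g) * D.u g) h = ξ h := by
  have hsum : hatF D (∑ g ∈ F, D.ι (ξ g) * D.u g) h =
      ∑ g ∈ F, hatF D (D.ι (ξ g) * D.u g) h := by
    simp only [hatF, Finset.sum_mul, map_sum]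
  rw [hsum, Finset.sum_eq_single_of_mem h hF fun g _ hg => D.hatF_iota_mul_u_of_ne _ hg,
    D.hatF_iota_mul_u_self]

/-- Each Fourier coefficient is dominated by the `α`-norm. -/
lemma norm_hatF_le_alphaNorm (D : CrossedProduct S B) (x : B) (h : G) :
    ‖hatF D x h‖ ≤ alphaNorm D x := by
  let _ : PartialOrder A := CStarAlgebra.spectralOrder A
  have : StarOrderedRing A := CStarAlgebra.spectralOrderedRing A
  have hnonneg : ∀ g, 0 ≤ (S.α g).symm (star (hatF D x g) * hatF D x g) := fun g => by
    rw [map_mul, map_star]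
    exact star_mul_self_nonneg _
  have hle : (S.α h).symm (star (hatF D x h) * hatF D x h) ≤ D.E (star x * x) := by
    rw [D.E_inner]
    exact (D.hat_mem x).le_tsum h fun g _ => hnonneg g
  have hnorm := CStarAlgebra.norm_le_norm_of_nonneg_of_le (hnonneg h) hle
  rw [StarAlgEquiv.norm_map, CStarRing.norm_star_mul_self] at hnorm
  exact Real.le_sqrt_of_sq_le (by rwa [sq])

end CrossedProduct

/-- Proposition `Four`. If the net of finite partial sums of
`∑_g ξ(g) λ_Σ(g)` converges to `x ∈ C*_r(Σ)` w.r.t. `‖·‖_α`, then `ξ ∈ A^Σ`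
and `ξ = x̂`. -/
theorem statement0 {A G B : Type*} [CStarAlgebra A] [Group G] [CStarAlgebra B]
    (S : TwistedSystem A G) (D : CrossedProduct S B) (ξ : G → A) (x : B)
    (hconv : Filter.Tendsto
      (fun F : Finset G => alphaNorm D ((∑ g ∈ F, D.ι (ξ g) * D.u g) - x))
      Filter.atTop (nhds 0)) :
    MemAS S ξ ∧ ξ = hatF D x := by
  have hξ : ξ = hatF D x := by
    funext h
    have hlim : Filter.Tendsto (fun _ : Finset G => ‖ξ h - hatF D x h‖) Filter.atTop (nhds 0) := by
      refine squeeze_zero' (Filter.Eventually.of_forall fun _ => norm_nonneg _) ?_ hconv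
      filter_upwards [Filter.eventually_ge_atTop {h}] with F hF
      have hle := D.norm_hatF_le_alphaNorm ((∑ g ∈ F, D.ι (ξ g) * D.u g) - x) h
      rwa [D.hatF_sub, D.hatF_sum_iota_mul_u ξ (Finset.singleton_subset_iff.mp hF)] at hle
    exact sub_eq_zero.mp (norm_eq_zero.mp (tendsto_nhds_unique tendsto_const_nhds hlim))
  refine ⟨?_, hξ⟩
  rw [hξ]
  exact D.hat_mem x

end BCFourier
end
end

section
/- Suppose Σ has the L-decay property with respect to a norm ‖·‖′ on a subspace L of A^Σ containing C_c(Σ), and let ξ ∈ L. Then ∑_{g∈G} ξ(g)λ_Σ(g) converges unconditionally in the operator norm to some x ∈ C*_r(Σ) satisfying x̂ = ξ. Moreover, denoting this x by Λ̃_Σ(ξ), the resulting map Λ̃_Σ : L → C*_r(Σ) satisfies Λ̃_Σ(L) = {x ∈ C*_r(Σ) : x̂ ∈ L} ⊆ CF(Σ). -/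
open scoped ComplexOrder

noncomputable section

namespace BCFourier

variable {A G B : Type*} [CStarAlgebra A] [Group G] [CStarAlgebra B]

variable {S : TwistedSystem A G}

namespace CrossedProduct

lemma star_u (D : CrossedProduct S B) (h : G) :
    star (D.u h) = D.ι (star (S.σ h⁻¹ h)) * D.u h⁻¹ := by
  have h₁ : D.u h⁻¹ * D.u h = D.ι (S.σ h⁻¹ h) := by
    rw [D.u_mul, inv_mul_cancel, D.u_one, mul_one]
  have h₂ : D.u h⁻¹ = D.ι (S.σ h⁻¹ h) * star (D.u h) := by
    rw [← h₁, mul_assoc, Unitary.mul_star_self_of_mem (D.u_unitary h), mul_one]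
  rw [h₂, ← mul_assoc, ← map_mul, Unitary.star_mul_self_of_mem (S.σ_unitary _ _), map_one,
    one_mul]

lemma E_iota_mul_u_mul_star_u_self (D : CrossedProduct S B) (a : A) (g : G) :
    D.E (D.ι a * D.u g * star (D.u g)) = a := by
  rw [mul_assoc, Unitary.mul_star_self_of_mem (D.u_unitary g), mul_one, D.E_iota]

lemma E_iota_mul_u_mul_star_u_of_ne (D : CrossedProduct S B) (a : A) {g h : G} (hgh : g ≠ h) :
    D.E (D.ι a * D.u g * star (D.u h)) = 0 := by
  have key : D.ι a * D.u g * star (D.u h) =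
      D.ι (a * S.α g (star (S.σ h⁻¹ h)) * S.σ g h⁻¹) * D.u (g * h⁻¹) := by
    rw [D.star_u, mul_assoc (D.ι a), ← mul_assoc (D.u g), D.covariance, mul_assoc (D.ι _) (D.u g),
      D.u_mul]
    simp only [map_mul, mul_assoc]
  rw [key]
  exact D.E_perp _ _ fun h₁ => hgh (mul_inv_eq_one.mp h₁)

/-- A convergent series `∑_g ξ(g) λ_Σ(g)` is the Fourier series of its sum. -/
lemma hatF_eq_of_hasSum (D : CrossedProduct S B) {ξ : G → A} {x : B}
    (hx : HasSum (fun g => D.ι (ξ g) * D.u g) x) : hatF D x = ξ := by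
  funext h
  have h₁ : HasSum (fun g => D.E (D.ι (ξ g) * D.u g * star (D.u h))) (hatF D x h) :=
    (hx.mul_right (star (D.u h))).mapL D.E
  have h₂ := hasSum_single (f := fun g => D.E (D.ι (ξ g) * D.u g * star (D.u h))) h
    fun g hg => D.E_iota_mul_u_mul_star_u_of_ne _ hg
  rw [D.E_iota_mul_u_mul_star_u_self] at h₂
  exact h₁.unique h₂

lemma hatF_injective (D : CrossedProduct S B) : Function.Injective (hatF D) := by
  intro x y hxy
  refine sub_eq_zero.mp (D.E_faithful _ ?_)
  have h : ∀ g, D.E ((x - y) * star (D.u g)) = 0 := fun g => by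
    rw [sub_mul, map_sub, sub_eq_zero]
    exact congrFun hxy g
  rw [D.E_inner]
  simp [innerAS, h]

lemma Lam_indicator (D : CrossedProduct S B) (F : Finset G) (ξ : G → A) :
    Lam D (Set.indicator (↑F : Set G) ξ) = ∑ g ∈ F, D.ι (ξ g) * D.u g := by
  classical
  rw [Lam, finsum_eq_sum_of_support_subset (s := F)]
  · exact Finset.sum_congr rfl fun g hg => by
      rw [Set.indicator_of_mem (Finset.mem_coe.mpr hg)]
  · intro g hg
    by_contra hgF
    exact hg (by simp [Set.indicator_of_notMem hgF])

lemma summable_of_tendsZeroAtInfty (D : CrossedProduct S B) {N : (G → A) → ℝ} {C : ℝ}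
    (hC : 0 < C) (hdecay : ∀ f : G → A, (Function.support f).Finite → ‖Lam D f‖ ≤ C * N f)
    {ξ : G → A} (hξ : TendsZeroAtInfty N ξ) : Summable fun g => D.ι (ξ g) * D.u g := by
  rw [summable_iff_vanishing_norm]
  intro ε hε
  obtain ⟨F₀, hF₀⟩ := hξ (ε / C) (div_pos hε hC)
  refine ⟨F₀, fun F hF => ?_⟩
  rw [← D.Lam_indicator]
  calc ‖Lam D (Set.indicator (↑F : Set G) ξ)‖ ≤ C * N (Set.indicator (↑F : Set G) ξ) :=
        hdecay _ (F.finite_toSet.subset Set.support_indicator_subset)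
    _ < ε := by rw [mul_comm]; exact (lt_div_iff₀ hC).mp (hF₀ F hF)

end CrossedProduct

/-- Proposition `L-decay`. If `Σ` has the `L`-decay property
w.r.t. a norm `N = ‖·‖′` on a subspace `Lsp` of `A^Σ` containing `C_c(Σ)`, then
for every `ξ ∈ Lsp` the series `∑_g ξ(g) λ_Σ(g)` converges unconditionally in
operator norm to some `x` with `x̂ = ξ`; moreover
`Λ̃_Σ(Lsp) = {x : x̂ ∈ Lsp} ⊆ CF(Σ)`. -/
theorem statement1 {A G B : Type*} [CStarAlgebra A] [Group G] [CStarAlgebra B]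
    (S : TwistedSystem A G) (D : CrossedProduct S B)
    (Lsp : Set (G → A)) (N : (G → A) → ℝ)
    -- `Lsp` is a subspace of `A^Σ` containing `C_c(Σ)`
    (hsubAS : ∀ ξ ∈ Lsp, MemAS S ξ)
    (hCc : ∀ f : G → A, (Function.support f).Finite → f ∈ Lsp)
    (hadd : ∀ ξ η, ξ ∈ Lsp → η ∈ Lsp → ξ + η ∈ Lsp)
    (hsmul : ∀ (c : ℂ) ξ, ξ ∈ Lsp → c • ξ ∈ Lsp)
    -- `N` is a norm on `Lsp`
    (hN0 : ∀ ξ ∈ Lsp, 0 ≤ N ξ)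
    (hNdef : ∀ ξ ∈ Lsp, N ξ = 0 → ξ = 0)
    (hNtri : ∀ ξ η, ξ ∈ Lsp → η ∈ Lsp → N (ξ + η) ≤ N ξ + N η)
    (hNsmul : ∀ (c : ℂ) ξ, ξ ∈ Lsp → N (c • ξ) = ‖c‖ * N ξ)
    -- `Σ` has the `Lsp`-decay property w.r.t. `N`
    (hinfty : ∀ ξ ∈ Lsp, TendsZeroAtInfty N ξ)
    (hdecay : ∃ C : ℝ, 0 < C ∧ ∀ f : G → A, (Function.support f).Finite →
        ‖Lam D f‖ ≤ C * N f) :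
    (∀ ξ ∈ Lsp, ∃ x : B, HasSum (fun g => D.ι (ξ g) * D.u g) x ∧ hatF D x = ξ) ∧
    {x : B | ∃ ξ ∈ Lsp, HasSum (fun g => D.ι (ξ g) * D.u g) x}
      = {x : B | hatF D x ∈ Lsp} ∧
    {x : B | hatF D x ∈ Lsp} ⊆ {x : B | CFmem D x} := by
  obtain ⟨C, hC, hdecay⟩ := hdecay
  have hasSum : ∀ ξ ∈ Lsp, ∃ x : B, HasSum (fun g => D.ι (ξ g) * D.u g) x ∧ hatF D x = ξ := by
    intro ξ hξ
    obtain ⟨x, hx⟩ := D.summable_of_tendsZeroAtInfty hC hdecay (hinfty ξ hξ)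
    exact ⟨x, hx, D.hatF_eq_of_hasSum hx⟩
  refine ⟨hasSum, Set.Subset.antisymm ?_ ?_, ?_⟩
  · rintro x ⟨ξ, hξ, hx⟩
    rwa [Set.mem_ofPred_eq, D.hatF_eq_of_hasSum hx]
  · intro x hx
    obtain ⟨y, hy, hyx⟩ := hasSum _ hx
    exact ⟨hatF D x, hx, D.hatF_injective hyx ▸ hy⟩
  · intro x hx
    obtain ⟨y, hy, -⟩ := hasSum _ hx
    exact ⟨y, hy⟩

end BCFourier
end
end

section
/- Suppose G is κ-decaying for some κ : G → [1,∞). Then Σ has the ℓ²_κ(G,A)-decay property with respect to ‖·‖_{2,κ}. Consequently, if x ∈ C*_r(Σ) and x̂ ∈ ℓ²_κ(G,A), then x ∈ CF(Σ), i.e. the Fourier series ∑_{g∈G} x̂(g)λ_Σ(g) converges to x in operator norm. -/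
open scoped ComplexOrder

noncomputable section

namespace BCFourier

variable {A G B : Type*} [CStarAlgebra A] [Group G] [CStarAlgebra B]

variable {S : TwistedSystem A G}

section States

variable [PartialOrder A] [StarOrderedRing A]

/-- Every nonnegative element of a unital C*-algebra has a norming positive functional
(here: the real part of one). -/
lemma exists_positive_functional_eq_norm (a : A) (ha : 0 ≤ a) :
    ∃ ψ : A →L[ℝ] ℝ, (∀ b, 0 ≤ b → 0 ≤ ψ b) ∧ ψ a = ‖a‖ := by
  rcases subsingleton_or_nontrivial A with h | h
  · exact ⟨0, by simp, by simp [Subsingleton.elim a 0]⟩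
  have hn : ‖1 + a‖ = 1 + ‖a‖ := by
    refine le_antisymm ((norm_add_le _ _).trans (by simp)) ?_
    have h1 : ‖a‖ ∈ spectrum ℝ a := CStarAlgebra.norm_mem_spectrum_of_nonneg ha
    have h2 : 1 + ‖a‖ ∈ spectrum ℝ (algebraMap ℝ A 1 + a) := by
      rw [add_comm (1 : ℝ), spectrum.add_mem_add_iff]
      exact h1
    have h3 := spectrum.norm_le_norm_of_mem h2
    rw [map_one] at h3
    exact (le_abs_self _).trans h3
  obtain ⟨φ, hφ, hφa⟩ := exists_dual_vector'' ℂ (1 + a)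
  have hle : ∀ b, ‖φ b‖ ≤ ‖b‖ := fun b => by
    simpa using φ.le_of_opNorm_le hφ b
  have hre : ∀ b, (φ b).re ≤ ‖b‖ := fun b => (Complex.re_le_norm _).trans (hle b)
  have hsum : (φ 1).re + (φ a).re = 1 + ‖a‖ := by
    rw [← Complex.add_re, ← map_add, hφa, ← hn]
    exact Complex.ofReal_re _
  have h1 : (φ 1).re = 1 := by
    have := hre 1
    have := hre a
    rw [norm_one] at *
    linarith
  refine ⟨Complex.reCLM.comp (φ.restrictScalars ℝ), fun b hb => ?_, ?_⟩
  · have h2 : ‖algebraMap ℝ A ‖b‖ - b‖ ≤ ‖b‖ := by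
      have hb' : b ≤ algebraMap ℝ A ‖b‖ := IsSelfAdjoint.le_algebraMap_norm_self
      refine (CStarAlgebra.norm_le_norm_of_nonneg_of_le (sub_nonneg.mpr hb')
        (sub_le_self _ hb)).trans ?_
      simp
    have h3 := (hre _).trans h2
    have h4 : (φ (algebraMap ℝ A ‖b‖)).re = ‖b‖ := by
      rw [Algebra.algebraMap_eq_smul_one]
      have := (φ.restrictScalars ℝ).map_smul ‖b‖ 1
      simp only [ContinuousLinearMap.coe_restrictScalars'] at this
      rw [this, Complex.smul_re, h1, smul_eq_mul, mul_one]
    rw [map_sub, Complex.sub_re, h4] at h3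
    simpa using h3
  · change (φ a).re = ‖a‖
    linarith

lemma sqrt_functional_star_mul_add_le (ψ : A →L[ℝ] ℝ) (hψ : ∀ b, 0 ≤ b → 0 ≤ ψ b) (x y : A) :
    √(ψ (star (x + y) * (x + y))) ≤ √(ψ (star x * x)) + √(ψ (star y * y)) := by
  have hx := hψ _ (star_mul_self_nonneg x)
  have hy := hψ _ (star_mul_self_nonneg y)
  set b := ψ (star x * y + star y * x) with hb
  have key : ∀ t : ℝ, 0 ≤ ψ (star y * y) * (t * t) + b * t + ψ (star x * x) := fun t => by
    have h := hψ _ (star_mul_self_nonneg (x + t • y))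
    have e : star (x + t • y) * (x + t • y)
        = (t * t) • (star y * y) + t • (star x * y + star y * x) + star x * x := by
      simp only [star_add, star_smul, star_trivial, add_mul, mul_add, smul_mul_assoc,
        mul_smul_comm, smul_smul, smul_add]
      abel
    rw [e, map_add, map_add, map_smul, map_smul, smul_eq_mul, smul_eq_mul, ← hb] at h
    linarith
  have hd := discrim_le_zero key
  rw [discrim] at hd
  have hexp : ψ (star (x + y) * (x + y)) = ψ (star x * x) + b + ψ (star y * y) := by
    rw [hb, ← map_add, ← map_add]
    congr 1
    simp only [star_add, add_mul, mul_add]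
    abel
  rw [hexp]
  refine Real.sqrt_le_iff.mpr ⟨by positivity, ?_⟩
  have hbb : b ≤ 2 * (√(ψ (star x * x)) * √(ψ (star y * y))) := by
    refine abs_le_of_sq_le_sq' ?_ (by positivity) |>.2
    rw [mul_pow, mul_pow, Real.sq_sqrt hx, Real.sq_sqrt hy]
    linarith
  rw [add_sq, Real.sq_sqrt hx, Real.sq_sqrt hy]
  linarith

lemma sqrt_functional_star_mul_sum_le (ψ : A →L[ℝ] ℝ) (hψ : ∀ b, 0 ≤ b → 0 ≤ ψ b)
    {ι : Type*} (s : Finset ι) (y : ι → A) :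
    √(ψ (star (∑ i ∈ s, y i) * ∑ i ∈ s, y i)) ≤ ∑ i ∈ s, √(ψ (star (y i) * y i)) := by
  classical
  induction s using Finset.induction_on with
  | empty => simp
  | insert i s hi ih =>
    rw [Finset.sum_insert hi, Finset.sum_insert hi]
    exact (sqrt_functional_star_mul_add_le ψ hψ _ _).trans (by gcongr)

lemma functional_star_mul_mul_le (ψ : A →L[ℝ] ℝ) (hψ : ∀ b, 0 ≤ b → 0 ≤ ψ b) (c y : A) :
    ψ (star (c * y) * (c * y)) ≤ ‖c‖ ^ 2 * ψ (star y * y) := by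
  have h := CStarAlgebra.star_left_conjugate_le_norm_smul (a := y) (b := star c * c)
  have h2 := hψ _ (sub_nonneg.mpr h)
  rw [map_sub, map_smul, smul_eq_mul, CStarRing.norm_star_mul_self, ← sq] at h2
  rw [star_mul]
  simp only [mul_assoc] at h2 ⊢
  linarith

end States

section Algebra

variable (D : CrossedProduct S B)

lemma CrossedProduct.ext_on_generators {M : Type*} [AddCommGroup M] [Module ℂ M]
    [TopologicalSpace M] [T2Space M] {F₁ F₂ : B →ₗ[ℂ] M} (h₁ : Continuous F₁)
    (h₂ : Continuous F₂) (h : ∀ a g, F₁ (D.ι a * D.u g) = F₂ (D.ι a * D.u g)) (y : B) :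
    F₁ y = F₂ y := by
  refine congr_fun (Continuous.ext_on D.generated h₁ h₂ ?_) y
  refine LinearMap.eqOn_span ?_
  rintro _ ⟨a, g, rfl⟩
  exact h a g

lemma TwistedSystem.continuous_alpha (S : TwistedSystem A G) (g : G) : Continuous (S.α g) :=
  (NonUnitalStarAlgHom.isometry (S.α g) (S.α g).injective).continuous

open Classical in
lemma CrossedProduct.E_iota_mul_u (a : A) (g : G) :
    D.E (D.ι a * D.u g) = if g = 1 then a else 0 := by
  split_ifs with h
  · rw [h, D.u_one, mul_one, D.E_iota]
  · exact D.E_perp a g h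

lemma CrossedProduct.E_iota_mul (a : A) (y : B) : D.E (D.ι a * y) = a * D.E y := by
  refine D.ext_on_generators (F₁ := D.E.toLinearMap ∘ₗ LinearMap.mulLeft ℂ (D.ι a))
    (F₂ := LinearMap.mulLeft ℂ a ∘ₗ D.E.toLinearMap) ?_ ?_ ?_ y
  · exact D.E.continuous.comp (continuous_const_mul _)
  · exact (continuous_const_mul _).comp D.E.continuous
  · intro b g
    simp only [LinearMap.comp_apply, LinearMap.mulLeft_apply, ContinuousLinearMap.coe_coe]
    rw [← mul_assoc, ← map_mul, E_iota_mul_u, E_iota_mul_u]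
    split_ifs <;> simp

lemma CrossedProduct.E_mul_iota (a : A) (y : B) : D.E (y * D.ι a) = D.E y * a := by
  refine D.ext_on_generators (F₁ := D.E.toLinearMap ∘ₗ LinearMap.mulRight ℂ (D.ι a))
    (F₂ := LinearMap.mulRight ℂ a ∘ₗ D.E.toLinearMap) ?_ ?_ ?_ y
  · exact D.E.continuous.comp (continuous_mul_const _)
  · exact (continuous_mul_const _).comp D.E.continuous
  · intro b g
    simp only [LinearMap.comp_apply, LinearMap.mulRight_apply, ContinuousLinearMap.coe_coe]
    by_cases h : g = 1
    · rw [h, D.u_one, mul_one, ← map_mul, D.E_iota, D.E_iota]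
    · rw [mul_assoc, D.covariance, ← mul_assoc, ← map_mul, D.E_perp _ _ h, D.E_perp _ _ h,
        zero_mul]

lemma CrossedProduct.u_mul_star (g : G) : D.u g * star (D.u g) = 1 :=
  Unitary.mul_star_self_of_mem (D.u_unitary g)

lemma CrossedProduct.u_star_mul (g : G) : star (D.u g) * D.u g = 1 :=
  Unitary.star_mul_self_of_mem (D.u_unitary g)

lemma CrossedProduct.iota_star_sigma_mul (g h : G) :
    D.ι (star (S.σ g h)) * D.ι (S.σ g h) = 1 := by
  rw [← map_mul, Unitary.star_mul_self_of_mem (S.σ_unitary g h), map_one]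

lemma CrossedProduct.E_conj_u (g : G) (y : B) :
    D.E (D.u g * y * star (D.u g)) = S.α g (D.E y) := by
  refine D.ext_on_generators (F₁ := D.E.toLinearMap ∘ₗ LinearMap.mulRight ℂ (star (D.u g)) ∘ₗ
      LinearMap.mulLeft ℂ (D.u g))
    (F₂ := (S.α g).toAlgEquiv.toLinearMap ∘ₗ D.E.toLinearMap) ?_ ?_ ?_ y
  · exact D.E.continuous.comp ((continuous_mul_const _).comp (continuous_const_mul _))
  · exact (S.continuous_alpha g).comp D.E.continuous
  · intro b h
    change D.E (D.u g * (D.ι b * D.u h) * star (D.u g)) = S.α g (D.E (D.ι b * D.u h))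
    rw [← mul_assoc, D.covariance]
    by_cases hh : h = 1
    · rw [hh, D.u_one, mul_one, mul_one, mul_assoc, D.u_mul_star, mul_one, D.E_iota, D.E_iota]
    · have e : D.u (g * h) * star (D.u g)
          = D.ι (star (S.σ (g * h * g⁻¹) g)) * D.u (g * h * g⁻¹) := by
        have h1 := D.u_mul (g * h * g⁻¹) g
        rw [inv_mul_cancel_right] at h1
        have h2 : D.u (g * h)
            = D.ι (star (S.σ (g * h * g⁻¹) g)) * (D.u (g * h * g⁻¹) * D.u g) := by
          rw [h1, ← mul_assoc, D.iota_star_sigma_mul, one_mul]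
        rw [h2, mul_assoc, mul_assoc (D.u (g * h * g⁻¹)), D.u_mul_star, mul_one]
      have hne : g * h * g⁻¹ ≠ 1 := by
        simpa [mul_inv_eq_one] using hh
      rw [mul_assoc (D.ι _), D.u_mul, mul_assoc, mul_assoc, e, ← mul_assoc (D.ι (S.σ g h)),
        ← map_mul, ← mul_assoc, ← map_mul, D.E_perp _ _ hne, D.E_perp _ _ hh, map_zero]

lemma hatF_iota_mul_u_mul (a : A) (g h : G) (x : B) :
    hatF D (D.ι a * D.u g * x) h
      = a * (S.α g (hatF D x (g⁻¹ * h)) * S.σ g (g⁻¹ * h)) := by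
  have e : star (D.u h) = star (D.u (g⁻¹ * h)) * star (D.u g) * D.ι (S.σ g (g⁻¹ * h)) := by
    have h1 := D.u_mul g (g⁻¹ * h)
    rw [mul_inv_cancel_left] at h1
    have h2 : D.u h = D.ι (star (S.σ g (g⁻¹ * h))) * (D.u g * D.u (g⁻¹ * h)) := by
      rw [h1, ← mul_assoc, D.iota_star_sigma_mul, one_mul]
    rw [h2, star_mul, star_mul, ← map_star, star_star]
  have e2 : D.ι a * D.u g * x * star (D.u h)
      = D.ι a * (D.u g * (x * star (D.u (g⁻¹ * h))) * star (D.u g) * D.ι (S.σ g (g⁻¹ * h))) := by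
    rw [e]
    simp only [mul_assoc]
  rw [hatF, e2, D.E_iota_mul, D.E_mul_iota, D.E_conj_u, hatF]

lemma Lam_eq_sum {f : G → A} {s : Finset G} (hs : Function.support f ⊆ s) :
    Lam D f = ∑ g ∈ s, D.ι (f g) * D.u g := by
  refine finsum_eq_sum_of_support_subset _ fun g hg => hs ?_
  rw [Function.mem_support] at hg ⊢
  rintro h
  simp [h] at hg

lemma hatF_Lam_mul {f : G → A} {s : Finset G} (hs : Function.support f ⊆ s) (x : B) (h : G) :
    hatF D (Lam D f * x) h
      = ∑ g ∈ s, f g * (S.α g (hatF D x (g⁻¹ * h)) * S.σ g (g⁻¹ * h)) := by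
  simp_rw [← hatF_iota_mul_u_mul, Lam_eq_sum D hs, hatF, Finset.sum_mul, map_sum]

lemma TwistedSystem.alpha_symm_conj (S : TwistedSystem A G) (g h : G) (c : A) :
    (S.α h).symm (star (S.α g c * S.σ g (g⁻¹ * h)) * (S.α g c * S.σ g (g⁻¹ * h)))
      = (S.α (g⁻¹ * h)).symm (star c * c) := by
  rw [StarAlgEquiv.symm_apply_eq]
  obtain ⟨d, hd⟩ : ∃ d, S.α (g⁻¹ * h) d = star c * c :=
    (S.α (g⁻¹ * h)).surjective (star c * c)
  rw [← hd, StarAlgEquiv.symm_apply_apply]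
  have h1 := S.alpha_mul g (g⁻¹ * h) d
  rw [mul_inv_cancel_left, hd, map_mul, map_star] at h1
  have hu := Unitary.star_mul_self_of_mem (S.σ_unitary g (g⁻¹ * h))
  calc _ = star (S.σ g (g⁻¹ * h)) * (star (S.α g c) * S.α g c) * S.σ g (g⁻¹ * h) := by
        simp only [star_mul, mul_assoc]
    _ = (star (S.σ g (g⁻¹ * h)) * S.σ g (g⁻¹ * h)) * S.α h d
        * (star (S.σ g (g⁻¹ * h)) * S.σ g (g⁻¹ * h)) := by
        rw [h1]; simp only [mul_assoc]
    _ = _ := by rw [hu, one_mul, mul_one]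

lemma hatF_eq_zero_imp (x : B) (hx : ∀ g, hatF D x g = 0) : x = 0 := by
  refine D.E_faithful x ?_
  rw [D.E_inner]
  change innerAS S (hatF D x) (hatF D x) = 0
  simp [innerAS, hx]

lemma hatF_iota_mul_u_self (a : A) (g : G) : hatF D (D.ι a * D.u g) g = a := by
  rw [hatF, mul_assoc, D.u_mul_star, mul_one, D.E_iota]

lemma hatF_iota_mul_u_of_ne (a : A) {g h : G} (hgh : h ≠ g) :
    hatF D (D.ι a * D.u g) h = 0 := by
  have e := hatF_iota_mul_u_mul D a g h 1
  have e1 : hatF D (1 : B) (g⁻¹ * h) = 0 := by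
    have h2 : g⁻¹ * h ≠ 1 := fun h3 => hgh (inv_mul_eq_one.mp h3).symm
    have h3 := D.u_mul (g⁻¹ * h)⁻¹ (g⁻¹ * h)
    have h4 : star (D.u (g⁻¹ * h)) = D.ι (star (S.σ (g⁻¹ * h)⁻¹ (g⁻¹ * h))) *
        D.u (g⁻¹ * h)⁻¹ := by
      rw [inv_mul_cancel, D.u_one, mul_one] at h3
      calc _ = D.ι (star (S.σ (g⁻¹ * h)⁻¹ (g⁻¹ * h))) * D.ι (S.σ (g⁻¹ * h)⁻¹ (g⁻¹ * h))
            * star (D.u (g⁻¹ * h)) := by rw [D.iota_star_sigma_mul, one_mul]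
        _ = _ := by
          rw [← h3, mul_assoc, mul_assoc, D.u_mul_star, mul_one]
    rw [hatF, one_mul, h4, D.E_perp _ _ (inv_ne_one.mpr h2)]
  rw [mul_one] at e
  rw [e, e1]
  simp

lemma functional_E_star_mul (ψ : A →L[ℝ] ℝ) (x : B) :
    HasSum (fun g => ψ ((S.α g).symm (star (hatF D x g) * hatF D x g)))
      (ψ (D.E (star x * x))) := by
  rw [D.E_inner]
  exact (D.hat_mem x).hasSum.mapL ψ

end Algebra

section Order

variable [PartialOrder A] [StarOrderedRing A] (D : CrossedProduct S B)

lemma alpha_symm_nonneg (g : G) (c : A) : 0 ≤ (S.α g).symm (star c * c) := by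
  rw [map_mul, map_star]
  exact star_mul_self_nonneg _

lemma E_nonneg (x : B) : 0 ≤ D.E (star x * x) := by
  rw [D.E_inner]
  exact tsum_nonneg fun g => alpha_symm_nonneg g _

variable [PartialOrder B] [StarOrderedRing B]

/-- An element acting boundedly for every seminorm `x ↦ ψ(E(x* x))^{1/2}` is bounded
in norm by the same constant. -/
lemma norm_le_of_functional_le (b : B) (K : ℝ) (hK : 0 ≤ K)
    (h : ∀ ψ : A →L[ℝ] ℝ, (∀ a, 0 ≤ a → 0 ≤ ψ a) → ∀ x : B,
      ψ (D.E (star (b * x) * (b * x))) ≤ K ^ 2 * ψ (D.E (star x * x))) : ‖b‖ ≤ K := by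
  have hsa : IsSelfAdjoint (star b * b - algebraMap ℝ B (K ^ 2)) :=
    (IsSelfAdjoint.star_mul_self b).sub (IsSelfAdjoint.algebraMap B (IsSelfAdjoint.all _))
  set d := star b * b - algebraMap ℝ B (K ^ 2) with hd
  set x := d⁺ with hx
  have hxnn : 0 ≤ x := CFC.posPart_nonneg d
  have hxs : star x = x := (IsSelfAdjoint.of_nonneg hxnn).star_eq
  have h3 : x * d * x = x ^ 3 := by
    have h4 := CFC.posPart_sub_negPart d hsa
    have h5 := CFC.posPart_mul_negPart d
    rw [← hx] at h4 h5
    rw [← h4, mul_sub, h5, sub_zero, pow_succ, sq]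
  obtain ⟨w, hw⟩ := CStarAlgebra.nonneg_iff_eq_star_mul_self.mp (CStarAlgebra.pow_nonneg hxnn 3)
  have hE : D.E (star w * w) = 0 := by
    obtain ⟨ψ, hψ, hψn⟩ := exists_positive_functional_eq_norm _ (E_nonneg D w)
    have h6 := h ψ hψ x
    have h7 : star (b * x) * (b * x) = star w * w + (K ^ 2) • (star x * x) := by
      rw [← hw, ← h3, hd, star_mul, hxs, mul_sub, sub_mul, Algebra.algebraMap_eq_smul_one]
      simp only [mul_smul_comm, smul_mul_assoc, mul_one, mul_assoc, sub_add_cancel]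
    have h8 : D.E ((K ^ 2) • (star x * x)) = (K ^ 2) • D.E (star x * x) :=
      (D.E.restrictScalars ℝ).map_smul _ _
    rw [h7, map_add, h8, map_add, map_smul, smul_eq_mul, hψn] at h6
    exact norm_le_zero_iff.mp (by linarith)
  have hw0 := D.E_faithful w hE
  rw [hw0, mul_zero] at hw
  have hx0 : x = 0 := by
    have h9 : x ^ 4 = 0 := by rw [pow_succ, hw, zero_mul]
    have h10 : ‖x ^ 4‖ = ‖x‖ ^ 4 := by
      have e1 : ‖x * x‖ = ‖x‖ * ‖x‖ := by
        simpa [hxs] using CStarRing.norm_star_mul_self (x := x)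
      have e2 : ‖(x * x) * (x * x)‖ = ‖x * x‖ * ‖x * x‖ := by
        simpa [hxs] using CStarRing.norm_star_mul_self (x := x * x)
      rw [show x ^ 4 = (x * x) * (x * x) by noncomm_ring, e2, e1]
      ring
    rw [h9, norm_zero] at h10
    exact norm_eq_zero.mp (pow_eq_zero_iff (by norm_num) |>.mp h10.symm)
  have hd0 : d ≤ 0 := (CFC.posPart_eq_zero_iff d hsa).mp hx0
  have hle : star b * b ≤ algebraMap ℝ B (K ^ 2) := sub_nonpos.mp hd0
  have := (CStarAlgebra.norm_le_iff_le_algebraMap _ (sq_nonneg K)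
    (star_mul_self_nonneg b)).mpr hle
  rw [CStarRing.norm_star_mul_self] at this
  exact abs_le_of_sq_le_sq' (by nlinarith) hK |>.2

lemma norm_Lam_le (κ : G → ℝ) (C : ℝ) (hC : 0 < C)
    (hdec : ∀ f : G → ℂ, (Function.support f).Finite →
        ∀ ξ : G → ℂ, Summable (fun g => ‖ξ g‖ ^ 2) →
        Summable (fun h => ‖∑ᶠ g, f g * ξ (g⁻¹ * h)‖ ^ 2) ∧
        √(∑' h, ‖∑ᶠ g, f g * ξ (g⁻¹ * h)‖ ^ 2) ≤
          C * √(∑' g, (‖f g‖ * κ g) ^ 2) * √(∑' g, ‖ξ g‖ ^ 2))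
    (f : G → A) (hf : (Function.support f).Finite) :
    ‖Lam D f‖ ≤ C * √(∑' g, (‖f g‖ * κ g) ^ 2) := by
  set K := C * √(∑' g, (‖f g‖ * κ g) ^ 2) with hK
  refine norm_le_of_functional_le D _ K (by positivity) fun ψ hψ x => ?_
  set ζ : G → ℝ := fun k => √(ψ ((S.α k).symm (star (hatF D x k) * hatF D x k))) with hζ
  have hζsq : ∀ k, ζ k ^ 2 = ψ ((S.α k).symm (star (hatF D x k) * hatF D x k)) := fun k =>
    Real.sq_sqrt (hψ _ (alpha_symm_nonneg k _))
  have hsumx := functional_E_star_mul D ψ x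
  have hsupp : Function.support f ⊆ hf.toFinset := by simp
  have hcsupp : Function.support (fun g => (‖f g‖ : ℂ)) = Function.support f := by
    ext g; simp
  have hconv : ∀ h, ∑ᶠ g, (‖f g‖ : ℂ) * (ζ (g⁻¹ * h) : ℂ)
      = ((∑ g ∈ hf.toFinset, ‖f g‖ * ζ (g⁻¹ * h) : ℝ) : ℂ) := fun h => by
    rw [finsum_eq_sum_of_support_subset (s := hf.toFinset)]
    · push_cast; rfl
    · intro g hg
      rw [Function.mem_support] at hg
      refine hsupp ?_
      rw [Function.mem_support]
      rintro h0
      simp [h0] at hg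
  have hξ : (fun g => ‖(ζ g : ℂ)‖ ^ 2)
      = fun g => ψ ((S.α g).symm (star (hatF D x g) * hatF D x g)) := by
    funext g
    rw [Complex.norm_real, Real.norm_eq_abs, sq_abs, hζsq]
  obtain ⟨hs, hle⟩ := hdec (fun g => (‖f g‖ : ℂ)) (by rwa [hcsupp]) (fun g => (ζ g : ℂ))
    (by rw [hξ]; exact hsumx.summable)
  rw [hξ, hsumx.tsum_eq] at hle
  simp only [hconv, Complex.norm_real, Real.norm_eq_abs, sq_abs, abs_norm] at hs hle
  rw [← hK] at hle
  have hterm : ∀ h, ψ ((S.α h).symm (star (hatF D (Lam D f * x) h) * hatF D (Lam D f * x) h))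
      ≤ (∑ g ∈ hf.toFinset, ‖f g‖ * ζ (g⁻¹ * h)) ^ 2 := fun h => by
    have hnn : 0 ≤ ∑ g ∈ hf.toFinset, ‖f g‖ * ζ (g⁻¹ * h) :=
      Finset.sum_nonneg fun g _ => mul_nonneg (norm_nonneg _) (Real.sqrt_nonneg _)
    refine (Real.sqrt_le_left hnn).mp ?_
    rw [hatF_Lam_mul D hsupp, map_mul, map_star, map_sum]
    refine (sqrt_functional_star_mul_sum_le ψ hψ _ _).trans (Finset.sum_le_sum fun g _ => ?_)
    refine Real.sqrt_le_iff.mpr ⟨mul_nonneg (norm_nonneg _) (Real.sqrt_nonneg _), ?_⟩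
    rw [map_mul (S.α h).symm (f g)]
    refine (functional_star_mul_mul_le ψ hψ _ _).trans ?_
    rw [mul_pow, hζsq, ← map_star, ← map_mul, S.alpha_symm_conj]
    gcongr
    · exact hψ _ (alpha_symm_nonneg _ _)
    · exact NonUnitalStarAlgHom.norm_apply_le (S.α h).symm (f g)
  have hsumL := functional_E_star_mul D ψ (Lam D f * x)
  rw [← hsumL.tsum_eq]
  refine (hsumL.summable.tsum_le_tsum hterm hs).trans ?_
  have h0 : 0 ≤ ψ (D.E (star x * x)) := hψ _ (E_nonneg D x)
  have h1 := (Real.sqrt_le_iff.mp hle).2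
  rwa [mul_pow, Real.sq_sqrt h0] at h1

end Order

lemma tsum_indicator_norm_sq {ι : Type*} (κ : ι → ℝ) (ξ : ι → A) (F : Finset ι) :
    ∑' g, (‖Set.indicator (↑F : Set ι) ξ g‖ * κ g) ^ 2 = ∑ g ∈ F, (‖ξ g‖ * κ g) ^ 2 := by
  rw [tsum_eq_sum (s := F)]
  · exact Finset.sum_congr rfl fun g hg => by simp [hg]
  · intro g hg
    simp [hg]

lemma tendsZeroAtInfty_of_summable {ι : Type*} (κ : ι → ℝ) (ξ : ι → A)
    (h : Summable fun g => (‖ξ g‖ * κ g) ^ 2) :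
    TendsZeroAtInfty (fun η => √(∑' g, (‖η g‖ * κ g) ^ 2)) ξ := by
  intro ε hε
  obtain ⟨s, hs⟩ := summable_iff_vanishing_norm.mp h (ε ^ 2) (by positivity)
  refine ⟨s, fun F hF => ?_⟩
  have := hs F hF
  rw [Real.norm_eq_abs] at this
  simp only [tsum_indicator_norm_sq]
  exact (Real.sqrt_lt' hε).mpr ((le_abs_self _).trans_lt this)

lemma hasSum_fourier_of_decay (D : CrossedProduct S B) (κ : G → ℝ) (C : ℝ) (hC : 0 < C)
    (hdec : ∀ f : G → A, (Function.support f).Finite →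
      ‖Lam D f‖ ≤ C * √(∑' g, (‖f g‖ * κ g) ^ 2))
    (x : B) (hx : Summable fun g => (‖hatF D x g‖ * κ g) ^ 2) :
    HasSum (fun g => D.ι (hatF D x g) * D.u g) x := by
  have hsum : Summable fun g => D.ι (hatF D x g) * D.u g := by
    rw [summable_iff_vanishing_norm]
    intro ε hε
    obtain ⟨s, hs⟩ := tendsZeroAtInfty_of_summable κ _ hx (ε / C) (by positivity)
    refine ⟨s, fun F hF => ?_⟩
    have hsub : Function.support (Set.indicator (↑F : Set G) (hatF D x)) ⊆ F :=
      Set.support_indicator_subset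
    have h1 := hdec _ (F.finite_toSet.subset hsub)
    have h2 : Lam D (Set.indicator (↑F : Set G) (hatF D x))
        = ∑ g ∈ F, D.ι (hatF D x g) * D.u g := by
      rw [Lam_eq_sum D hsub]
      exact Finset.sum_congr rfl fun g hg => by simp [hg]
    rw [h2] at h1
    have h3 := (lt_div_iff₀ hC).mp (hs F hF)
    linarith
  obtain ⟨y, hy⟩ := hsum
  have hyx : ∀ h, hatF D y h = hatF D x h := fun h => by
    have h1 : HasSum (fun g => hatF D (D.ι (hatF D x g) * D.u g) h) (hatF D y h) :=
      (hy.mul_right (star (D.u h))).mapL D.E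
    have h2 := hasSum_single (f := fun g => hatF D (D.ι (hatF D x g) * D.u g) h) h
      fun g hg => hatF_iota_mul_u_of_ne D _ hg.symm
    rw [h1.unique h2, hatF_iota_mul_u_self]
  have : y - x = 0 := hatF_eq_zero_imp D _ fun g => by
    have h1 := hyx g
    simp only [hatF] at h1 ⊢
    rw [sub_mul, map_sub, h1, sub_self]
  exact sub_eq_zero.mp this ▸ hy

/-- Proposition `k-decay`. If `G` is `κ`-decaying, then `Σ`
has the `ℓ²_κ(G,A)`-decay property w.r.t. `‖·‖_{2,κ}`; consequently, if
`x ∈ C*_r(Σ)` and `x̂ ∈ ℓ²_κ(G,A)`, then the Fourier series of `x` converges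
to `x` in operator norm. -/
theorem statement2 {A G B : Type*} [CStarAlgebra A] [Group G] [CStarAlgebra B]
    (S : TwistedSystem A G) (D : CrossedProduct S B) (κ : G → ℝ)
    (hκ : ∀ g, 1 ≤ κ g)
    -- `G` is `κ`-decaying
    (hGdec : ∃ C : ℝ, 0 < C ∧ ∀ f : G → ℂ, (Function.support f).Finite →
        ∀ ξ : G → ℂ, Summable (fun g => ‖ξ g‖ ^ 2) →
        Summable (fun h => ‖∑ᶠ g, f g * ξ (g⁻¹ * h)‖ ^ 2) ∧
        Real.sqrt (∑' h, ‖∑ᶠ g, f g * ξ (g⁻¹ * h)‖ ^ 2) ≤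
          C * Real.sqrt (∑' g, (‖f g‖ * κ g) ^ 2) * Real.sqrt (∑' g, ‖ξ g‖ ^ 2)) :
    -- `Σ` has the `ℓ²_κ(G,A)`-decay property w.r.t. `‖·‖_{2,κ}` ...
    ((∀ ξ : G → A, Summable (fun g => (‖ξ g‖ * κ g) ^ 2) →
        TendsZeroAtInfty (fun η => Real.sqrt (∑' g, (‖η g‖ * κ g) ^ 2)) ξ) ∧
      ∃ C : ℝ, 0 < C ∧ ∀ f : G → A, (Function.support f).Finite →
        ‖Lam D f‖ ≤ C * Real.sqrt (∑' g, (‖f g‖ * κ g) ^ 2)) ∧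
    -- ... and the Fourier series of any `x` with `x̂ ∈ ℓ²_κ(G,A)` converges to `x`
    ∀ x : B, Summable (fun g => (‖hatF D x g‖ * κ g) ^ 2) →
      HasSum (fun g => D.ι (hatF D x g) * D.u g) x := by
  let _ : PartialOrder A := CStarAlgebra.spectralOrder A
  let _ : PartialOrder B := CStarAlgebra.spectralOrder B
  have : StarOrderedRing A := CStarAlgebra.spectralOrderedRing A
  have : StarOrderedRing B := CStarAlgebra.spectralOrderedRing B
  obtain ⟨C, hC, hdec⟩ := hGdec
  have hLam := norm_Lam_le D κ C hC hdec
  exact ⟨⟨tendsZeroAtInfty_of_summable κ, C, hC, hLam⟩,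
    hasSum_fourier_of_decay D κ C hC hLam⟩

end BCFourier
end
end

section
/- Let (ρ, v) be an equivariant representation of Σ on a Hilbert A-module X and let x, y ∈ X. Define T : G × A → A by T(g,a) = ⟨x, ρ(a)v(g)y⟩. Then T is a cb-multiplier of Σ (T ∈ M₀A(Σ)), ‖|T|‖ = ‖M_T‖ ≤ ‖M_T‖_cb ≤ ‖x‖‖y‖, and M_T : C*_r(Σ) → C*_r(Σ) satisfies M_T(a λ_Σ(g)) = ⟨x, ρ(a)v(g)y⟩ λ_Σ(g) for all a ∈ A, g ∈ G. If x = y, then M_T is completely positive and ‖|T|‖ = ‖M_T‖ = ‖M_T‖_cb = ‖x‖². -/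
open scoped ComplexOrder

noncomputable section

namespace BCFourier

variable {A G B : Type*} [CStarAlgebra A] [Group G] [CStarAlgebra B]

variable {S : TwistedSystem A G}

/-! ### Generalities on C⋆-algebras -/

section General

variable {C : Type*} [CStarAlgebra C]

lemma exists_star_mul_self_add_eq (c : C) {r : ℝ} (hr : ‖c‖ ≤ r) :
    ∃ e : C, star e * e + star c * c = algebraMap ℂ C ((r ^ 2 : ℝ) : ℂ) := by
  let _ := CStarAlgebra.spectralOrder C
  let _ := CStarAlgebra.spectralOrderedRing C
  have h : star c * c ≤ algebraMap ℝ C (r ^ 2) :=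
    (CStarAlgebra.star_mul_le_algebraMap_norm_sq (a := c)).trans
      (algebraMap_mono C (pow_le_pow_left₀ (norm_nonneg c) hr 2))
  obtain ⟨e, he⟩ := CStarAlgebra.nonneg_iff_eq_star_mul_self.mp (sub_nonneg.mpr h)
  exact ⟨e, by rw [← he, sub_add_cancel]; rfl⟩

lemma eq_zero_of_mul_self_mul_self {c : C} (hc : IsSelfAdjoint c) (h : c * c * c = 0) : c = 0 := by
  have h2 : star (c * c) * (c * c) = 0 := by
    rw [star_mul, hc.star_eq, ← mul_assoc, h, zero_mul]
  have h3 : star c * c = 0 := by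
    rw [hc.star_eq]; exact (CStarRing.star_mul_self_eq_zero_iff _).mp h2
  exact (CStarRing.star_mul_self_eq_zero_iff _).mp h3

variable [PartialOrder C] [StarOrderedRing C]

lemma norm_sum_star_mul_self_nonneg {κ : Type*} [Fintype κ] (x : κ → C) :
    0 ≤ ∑ k, star (x k) * x k :=
  Finset.sum_nonneg fun k _ => star_mul_self_nonneg (x k)

end General

/-! ### The norm on matrices -/

section Matrix

variable {n : ℕ}

lemma vecNorm_nonneg (x : Fin n → B) : 0 ≤ vecNorm x := Real.sqrt_nonneg _

lemma vecNorm_sq (x : Fin n → B) : vecNorm x ^ 2 = ‖∑ i, star (x i) * x i‖ :=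
  Real.sq_sqrt (norm_nonneg _)

lemma matNorm_le {m : Matrix (Fin n) (Fin n) B} {K : ℝ} (hK : 0 ≤ K)
    (h : ∀ x : Fin n → B, vecNorm (m.mulVec x) ≤ K * vecNorm x) : matNorm m ≤ K :=
  csInf_le ⟨0, fun _ h => h.1⟩ ⟨hK, h⟩

lemma matNorm_nonneg (m : Matrix (Fin n) (Fin n) B) : 0 ≤ matNorm m :=
  Real.sInf_nonneg fun _ h => h.1

lemma cstarMatrix_norm_le {m : Matrix (Fin n) (Fin n) B} {K : ℝ} (hK : 0 ≤ K)
    (h : ∀ x : Fin n → B, vecNorm (m.mulVec x) ≤ K * vecNorm x) :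
    letI := CStarAlgebra.spectralOrder B
    letI := CStarAlgebra.spectralOrderedRing B
    ‖CStarMatrix.ofMatrix m‖ ≤ K := by
  let _ := CStarAlgebra.spectralOrder B
  let _ := CStarAlgebra.spectralOrderedRing B
  rw [← norm_star (CStarMatrix.ofMatrix m), CStarMatrix.norm_def]
  refine ContinuousLinearMap.opNorm_le_bound _ hK fun v => ?_
  have := h fun i => star (v i)
  simp only [vecNorm] at this
  rw [WithCStarModule.pi_norm, WithCStarModule.pi_norm]
  simpa [CStarMatrix.toCLM_apply_eq_sum, Matrix.mulVec, dotProduct,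
    CStarMatrix.star_apply, WithCStarModule.inner_def] using this

lemma vecNorm_mulVec_le_cstarMatrix_norm (m : Matrix (Fin n) (Fin n) B) (x : Fin n → B) :
    letI := CStarAlgebra.spectralOrder B
    letI := CStarAlgebra.spectralOrderedRing B
    vecNorm (m.mulVec x) ≤ ‖CStarMatrix.ofMatrix m‖ * vecNorm x := by
  let _ := CStarAlgebra.spectralOrder B
  let _ := CStarAlgebra.spectralOrderedRing B
  rw [← norm_star (CStarMatrix.ofMatrix m), CStarMatrix.norm_def]
  have := (CStarMatrix.toCLM (star (CStarMatrix.ofMatrix m))).le_opNorm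
    ((WithCStarModule.equiv B (Fin n → B)).symm fun i => star (x i))
  rw [WithCStarModule.pi_norm, WithCStarModule.pi_norm] at this
  simp only [vecNorm]
  simpa [CStarMatrix.toCLM_apply_eq_sum, Matrix.mulVec, dotProduct,
    CStarMatrix.star_apply, WithCStarModule.inner_def] using this

lemma exists_matrix_star_mul_self_add_eq (m : Matrix (Fin n) (Fin n) B) :
    ∃ e : Matrix (Fin n) (Fin n) B, ∀ j l,
      ∑ i, (star (e i j) * e i l + star (m i j) * m i l) =
        if j = l then ((matNorm m ^ 2 : ℝ) : ℂ) • 1 else 0 := by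
  let _ := CStarAlgebra.spectralOrder B
  let _ := CStarAlgebra.spectralOrderedRing B
  have h : ‖CStarMatrix.ofMatrix m‖ ≤ matNorm m :=
    le_csInf ⟨_, norm_nonneg _, vecNorm_mulVec_le_cstarMatrix_norm m⟩
      fun K hK => cstarMatrix_norm_le hK.1 hK.2
  obtain ⟨e, he⟩ := exists_star_mul_self_add_eq (CStarMatrix.ofMatrix m) h
  refine ⟨CStarMatrix.ofMatrix.symm e, fun j l => ?_⟩
  have := congrFun (congrFun he j) l
  rw [CStarMatrix.add_apply, CStarMatrix.mul_apply, CStarMatrix.mul_apply,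
    ← Finset.sum_add_distrib] at this
  refine this.trans ?_
  rw [CStarMatrix.algebraMap_apply, Algebra.algebraMap_eq_smul_one]

lemma norm_one_le_one : ‖(1 : B)‖ ≤ 1 := by
  cases subsingleton_or_nontrivial B
  · simp [Subsingleton.elim (1 : B) 0]
  · exact CStarRing.norm_one.le

lemma matNorm_singleton (b : B) : matNorm !![b] = ‖b‖ := by
  have hv (x : Fin 1 → B) : vecNorm x = ‖x 0‖ := by
    simp [vecNorm, CStarRing.norm_star_mul_self, Real.sqrt_mul_self]
  have hm (x : Fin 1 → B) : (Matrix.mulVec !![b] x) 0 = b * x 0 := by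
    simp [Matrix.mulVec, dotProduct]
  have hmem : ∀ x : Fin 1 → B, vecNorm (Matrix.mulVec !![b] x) ≤ ‖b‖ * vecNorm x := fun x => by
    rw [hv, hv, hm]; exact norm_mul_le _ _
  refine le_antisymm (matNorm_le (norm_nonneg b) hmem) (le_csInf ⟨_, norm_nonneg b, hmem⟩ ?_)
  rintro K ⟨hK, h⟩
  have := h fun _ => 1
  rw [hv, hv, hm, mul_one] at this
  exact this.trans (mul_le_of_le_one_right hK norm_one_le_one)

end Matrix

/-! ### Hilbert modules and their representations -/

namespace HilbMod

variable [PartialOrder A] [StarOrderedRing A] {X : Type*} [NormedAddCommGroup X] [NormedSpace ℂ X]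
  (hX : HilbMod A X)

lemma inner_add_left (x y z : X) : hX.inner (x + y) z = hX.inner x z + hX.inner y z := by
  rw [← hX.inner_conj, hX.inner_add_right, star_add, hX.inner_conj, hX.inner_conj]

lemma inner_smulA_left (x y : X) (a : A) : hX.inner (hX.smulA x a) y = star a * hX.inner x y := by
  rw [← hX.inner_conj, hX.inner_smulA_right, star_mul, hX.inner_conj]

lemma norm_sq_eq (x : X) : ‖x‖ ^ 2 = ‖hX.inner x x‖ := by
  rw [hX.norm_eq, Real.sq_sqrt (norm_nonneg _)]

lemma norm_sq_le_of_inner_le {x y : X} {r : ℝ} (hr : 0 ≤ r)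
    (h : hX.inner x x ≤ ((r ^ 2 : ℝ) : ℂ) • hX.inner y y) : ‖x‖ ≤ r * ‖y‖ := by
  refine le_of_sq_le_sq ?_ (by positivity)
  rw [mul_pow, hX.norm_sq_eq, hX.norm_sq_eq]
  refine (CStarAlgebra.norm_le_norm_of_nonneg_of_le (hX.inner_self_nonneg x) h).trans ?_
  rw [norm_smul, Complex.norm_real, Real.norm_of_nonneg (by positivity)]

lemma norm_inner_le (x y : X) : ‖hX.inner x y‖ ≤ Real.sqrt (‖x‖ ^ 2 + 1) * ‖y‖ := by
  set b := hX.inner x y with hb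
  set r := ‖x‖ ^ 2 + 1 with hr
  have hr0 : 0 < r := by positivity
  set p := star b * b with hp
  have hp0 : 0 ≤ p := star_mul_self_nonneg b
  have h0 := hX.inner_self_nonneg (hX.smulA x (((-r⁻¹ : ℝ) : ℂ) • b) + y)
  rw [hX.inner_add_right, hX.inner_add_left, hX.inner_add_left, hX.inner_smulA_right,
    hX.inner_smulA_left, hX.inner_smulA_left, hX.inner_smulA_right, ← hX.inner_conj x y,
    ← hb, star_smul, Complex.star_def, Complex.conj_ofReal] at h0
  have h1 : star b * hX.inner x x * b ≤ r • p := by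
    refine (CStarAlgebra.star_left_conjugate_le_norm_smul
      (IsSelfAdjoint.of_nonneg (hX.inner_self_nonneg x))).trans ?_
    rw [← hX.norm_sq_eq]
    exact smul_le_smul_of_nonneg_right (by simp [hr]) hp0
  have h2 : (r⁻¹ ^ 2) • (star b * hX.inner x x * b) ≤ r⁻¹ • p := by
    refine (smul_le_smul_of_nonneg_left h1 (by positivity)).trans_eq ?_
    rw [smul_smul]; congr 1; field_simp
  have h3 : r⁻¹ • p ≤ hX.inner y y := by
    have e1 : ((-r⁻¹ : ℝ) : ℂ) • star b * hX.inner x x * (((-r⁻¹ : ℝ) : ℂ) • b) +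
        star b * (((-r⁻¹ : ℝ) : ℂ) • b) + (((-r⁻¹ : ℝ) : ℂ) • star b * b + hX.inner y y) =
        (r⁻¹ ^ 2) • (star b * hX.inner x x * b) - r⁻¹ • p - r⁻¹ • p + hX.inner y y := by
      simp only [Complex.coe_smul, neg_smul, neg_mul, mul_neg, neg_neg, smul_neg, smul_mul_assoc,
        mul_smul_comm, smul_smul, ← sq, ← hp]
      abel
    rw [e1] at h0
    have : r⁻¹ • p + r⁻¹ • p ≤ r⁻¹ • p + hX.inner y y := by
      have := h0.trans (add_le_add_left (sub_le_sub_right (sub_le_sub_right h2 (r⁻¹ • p))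
        (r⁻¹ • p)) (hX.inner y y))
      simpa [sub_eq_add_neg, add_comm] using this
    exact le_of_add_le_add_left this
  have h4 := CStarAlgebra.norm_le_norm_of_nonneg_of_le (smul_nonneg (by positivity) hp0) h3
  rw [norm_smul, hp, CStarRing.norm_star_mul_self, ← hX.norm_sq_eq,
    Real.norm_of_nonneg (by positivity), inv_mul_le_iff₀ hr0] at h4
  refine le_of_sq_le_sq ?_ (by positivity)
  rw [mul_pow, Real.sq_sqrt hr0.le, sq ‖b‖]
  exact h4

/-- The functional `y ↦ ⟨x, y⟩` on a Hilbert module. -/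
def innerL (x : X) : X →L[ℂ] A :=
  LinearMap.mkContinuous
    { toFun := hX.inner x
      map_add' := hX.inner_add_right x
      map_smul' := fun c y => hX.inner_smul_right c x y } _ (hX.norm_inner_le x)

@[simp] lemma innerL_apply (x y : X) : hX.innerL x y = hX.inner x y := rfl

lemma inner_sum_right {κ : Type*} (s : Finset κ) (x : X) (y : κ → X) :
    hX.inner x (∑ k ∈ s, y k) = ∑ k ∈ s, hX.inner x (y k) :=
  map_sum (hX.innerL x) y s

lemma inner_sum_left {κ : Type*} (s : Finset κ) (x : κ → X) (y : X) :
    hX.inner (∑ k ∈ s, x k) y = ∑ k ∈ s, hX.inner (x k) y := by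
  rw [← hX.inner_conj, inner_sum_right, star_sum]
  exact Finset.sum_congr rfl fun k _ => hX.inner_conj _ _

end HilbMod

section Rep

variable [PartialOrder A] [StarOrderedRing A] {X : Type*} [NormedAddCommGroup X] [NormedSpace ℂ X]
  {hX : HilbMod A X} {π : A → X →L[ℂ] X}

lemma IsRepOn.inner_apply_apply (h : IsRepOn hX π) (a b : A) (x y : X) :
    hX.inner (π a x) (π b y) = hX.inner x (π (star a * b) y) := by
  obtain ⟨-, hmul, -, -, hstar, -⟩ := h
  rw [hstar, hmul]

lemma IsRepOn.norm_le (h : IsRepOn hX π) (a : A) : ‖π a‖ ≤ ‖a‖ := by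
  refine ContinuousLinearMap.opNorm_le_bound _ (norm_nonneg a) fun x => ?_
  refine hX.norm_sq_le_of_inner_le (norm_nonneg a) ?_
  obtain ⟨e, he⟩ := exists_star_mul_self_add_eq a le_rfl
  have key : hX.inner (π e x) (π e x) + hX.inner (π a x) (π a x) =
      ((‖a‖ ^ 2 : ℝ) : ℂ) • hX.inner x x := by
    rw [h.inner_apply_apply, h.inner_apply_apply, ← hX.inner_add_right, ← add_apply,
      ← h.2.2.1, he, Algebra.algebraMap_eq_smul_one, h.2.2.2.1, h.1]
    exact hX.inner_smul_right _ _ _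
  rw [← key]
  exact le_add_of_nonneg_left (hX.inner_self_nonneg _)

/-- A representation on a Hilbert module, as a continuous linear map. -/
def IsRepOn.toCLM (h : IsRepOn hX π) : A →L[ℂ] X →L[ℂ] X :=
  LinearMap.mkContinuous
    { toFun := π
      map_add' := h.2.2.1
      map_smul' := h.2.2.2.1 } 1 fun a => by simpa using h.norm_le a

@[simp] lemma IsRepOn.toCLM_apply (h : IsRepOn hX π) (a : A) : h.toCLM a = π a := rfl

lemma IsRepOn.map_sum {κ : Type*} (h : IsRepOn hX π) (s : Finset κ) (a : κ → A) (x : X) :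
    π (∑ k ∈ s, a k) x = ∑ k ∈ s, π (a k) x := by
  rw [← h.toCLM_apply, _root_.map_sum, _root_.sum_apply]; rfl

end Rep

/-! ### The conditional expectation of a crossed product -/

namespace CrossedProduct

variable (D : CrossedProduct S B)

lemma star_u_mul_u (g : G) : star (D.u g) * D.u g = 1 :=
  Unitary.star_mul_self_of_mem (D.u_unitary g)

lemma u_mul_star_u_s8 (g : G) : D.u g * star (D.u g) = 1 :=
  Unitary.mul_star_self_of_mem (D.u_unitary g)

lemma iota_mul_u (g : G) (a : A) : D.ι a * D.u g = D.u g * D.ι ((S.α g).symm a) := by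
  rw [D.covariance, StarAlgEquiv.apply_symm_apply]

lemma E_star_u_mul_iota_mul_u [DecidableEq G] (g h : G) (a : A) :
    D.E (star (D.u g) * (D.ι a * D.u h)) = if g = h then (S.α g).symm a else 0 := by
  split_ifs with hgh
  · subst hgh
    rw [D.iota_mul_u, ← mul_assoc, D.star_u_mul_u, one_mul, D.E_iota]
  · have h1 : star (D.u g) = D.ι (star (S.σ g⁻¹ g)) * D.u g⁻¹ := by
      have h2 : D.u g⁻¹ * D.u g = D.ι (S.σ g⁻¹ g) := by
        rw [D.u_mul, inv_mul_cancel, D.u_one, mul_one]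
      have h3 : D.u g⁻¹ = D.ι (S.σ g⁻¹ g) * star (D.u g) := by
        rw [← h2, mul_assoc, D.u_mul_star_u_s8, mul_one]
      rw [h3, ← mul_assoc, ← map_mul, Unitary.star_mul_self_of_mem (S.σ_unitary _ _), map_one,
        one_mul]
    rw [h1, mul_assoc, ← mul_assoc (D.u g⁻¹), D.covariance, mul_assoc, D.u_mul, ← mul_assoc,
      ← mul_assoc, ← map_mul, ← map_mul]
    exact D.E_perp _ _ fun h0 => hgh (inv_mul_eq_one.mp h0)

lemma E_star_u_mul_u [DecidableEq G] (g h : G) :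
    D.E (star (D.u g) * D.u h) = if g = h then 1 else 0 := by
  have := D.E_star_u_mul_iota_mul_u g h 1
  rwa [map_one, one_mul, map_one] at this

lemma clm_ext {F : Type*} [NormedAddCommGroup F] [NormedSpace ℂ F] {f g : B →L[ℂ] F}
    (h : ∀ a k, f (D.ι a * D.u k) = g (D.ι a * D.u k)) : f = g := by
  refine ContinuousLinearMap.ext_on D.generated ?_
  rintro _ ⟨a, k, rfl⟩
  exact h a k

lemma E_star (b : B) : D.E (star b) = star (D.E b) := by
  classical
  let f : B →L[ℂ] A :=
    { toFun := fun b => star (D.E (star b))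
      map_add' := fun x y => by simp
      map_smul' := fun c x => by simp
      cont := by fun_prop }
  have : D.E = f := by
    refine D.clm_ext fun a k => ?_
    have e := D.E_star_u_mul_iota_mul_u k 1 (star a)
    rw [D.u_one, mul_one] at e
    change _ = star (D.E (star (D.ι a * D.u k)))
    rw [star_mul, ← map_star D.ι, e]
    split_ifs with hk
    · subst hk
      have h1 : D.ι (S.α 1 ((S.α 1).symm (star a))) = D.ι ((S.α 1).symm (star a)) := by
        have := D.covariance 1 ((S.α 1).symm (star a))
        rw [D.u_one, mul_one, one_mul] at this
        exact this.symm
      have h2 : (S.α 1).symm (star a) = star a := by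
        rw [StarAlgEquiv.apply_symm_apply] at h1
        rw [← D.E_iota ((S.α 1).symm (star a)), ← h1, D.E_iota]
      rw [h2, star_star, D.u_one, mul_one, D.E_iota]
    · rw [D.E_perp a k hk, star_zero]
  have h := congrArg star (DFunLike.congr_fun this b)
  rw [h]
  exact (star_star _).symm

lemma E_iota_mul_s8 (a : A) (b : B) : D.E (D.ι a * b) = a * D.E b := by
  classical
  have : D.E.comp (ContinuousLinearMap.mul ℂ B (D.ι a)) =
      (ContinuousLinearMap.mul ℂ A a).comp D.E := by
    refine D.clm_ext fun c k => ?_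
    change D.E (D.ι a * (D.ι c * D.u k)) = a * D.E (D.ι c * D.u k)
    rw [← mul_assoc, ← map_mul]
    by_cases hk : k = 1
    · subst hk
      rw [D.u_one, mul_one, mul_one, D.E_iota, D.E_iota]
    · rw [D.E_perp _ _ hk, D.E_perp _ _ hk, mul_zero]
  exact DFunLike.congr_fun this b

lemma E_mul_iota_s8 (b : B) (a : A) : D.E (b * D.ι a) = D.E b * a := by
  have := congrArg star (D.E_iota_mul_s8 (star a) (star b))
  rw [← D.E_star] at this
  simpa [D.E_star, map_star] using this

/-- The element `∑ₖ u_{s(k)} ι(aₖ)` of a crossed product. -/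
def comb {F : Type*} [Fintype F] (s : F → G) (a : F → A) : B := ∑ k, D.u (s k) * D.ι (a k)

lemma E_star_comb_mul_mul_comb {F : Type*} [Fintype F] (s : F → G) (c d : F → A) (w : B) :
    D.E (star (D.comb s c) * w * D.comb s d) =
      ∑ k, ∑ l, star (c k) * D.E (star (D.u (s k)) * w * D.u (s l)) * d l := by
  simp only [comb, star_sum, Finset.sum_mul, Finset.mul_sum, map_sum]
  refine (Finset.sum_congr rfl fun k _ => Finset.sum_congr rfl fun l _ => ?_).trans
    (Finset.sum_comm)
  rw [← D.E_iota_mul_s8, ← D.E_mul_iota_s8, map_star, star_mul]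
  simp only [mul_assoc]

lemma E_star_comb_mul_comb {F : Type*} [Fintype F] {s : F → G} (hs : Function.Injective s)
    (c d : F → A) :
    D.E (star (D.comb s c) * D.comb s d) = ∑ k, star (c k) * d k := by
  classical
  have := D.E_star_comb_mul_mul_comb s c d 1
  rw [mul_one] at this
  rw [this]
  simp [D.E_star_u_mul_u, hs.eq_iff]

lemma closed_induction {κ : Type*} [Finite κ] {P : (κ → B) → Prop} (hP : IsClosed {ξ | P ξ})
    (h : ∀ (F : Finset G) (d : κ → F → A), P fun k => D.comb Subtype.val (d k)) (ξ : κ → B) :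
    P ξ := by
  classical
  have := Fintype.ofFinite κ
  let Φ : (G →₀ A) →ₗ[ℂ] B :=
    Finsupp.lsum ℂ fun g => (LinearMap.mulLeft ℂ (D.u g)).comp D.ι.toAlgHom.toLinearMap
  have hΦ : DenseRange Φ := by
    refine D.generated.mono ?_
    change _ ⊆ ((LinearMap.range Φ : Submodule ℂ B) : Set B)
    rw [SetLike.coe_subset_coe, Submodule.span_le]
    rintro _ ⟨a, g, rfl⟩
    refine ⟨Finsupp.single g ((S.α g).symm a), ?_⟩
    rw [D.iota_mul_u]
    simp [Φ]
  refine (DenseRange.piMap fun _ : κ => hΦ).induction_on (p := P) ξ hP fun f => ?_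
  let F : Finset G := Finset.univ.biUnion fun k => (f k).support
  convert h F fun k g => f k g with k
  change Φ (f k) = ∑ g : F, D.u g * D.ι (f k g)
  rw [Finset.sum_coe_sort F fun g => D.u g * D.ι (f k g)]
  change (f k).sum (fun g a => D.u g * D.ι a) = _
  exact Finsupp.sum_of_support_subset _
    (Finset.subset_biUnion_of_mem (fun k => (f k).support) (Finset.mem_univ k)) _ (by simp)

variable [PartialOrder A] [StarOrderedRing A]

lemma E_star_mul_self_nonneg (b : B) : 0 ≤ D.E (star b * b) := by
  refine D.closed_induction (κ := Unit) (P := fun ξ => 0 ≤ D.E (star (ξ ()) * ξ ())) ?_ ?_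
    fun _ => b
  · exact (CStarAlgebra.isClosed_nonneg (A := A)).preimage (by fun_prop)
  · intro F d
    rw [D.E_star_comb_mul_comb Subtype.val_injective]
    exact norm_sum_star_mul_self_nonneg _

variable [PartialOrder B] [StarOrderedRing B]

lemma nonneg_of_E_of_isSelfAdjoint {w : B} (hw : IsSelfAdjoint w)
    (h : ∀ d, 0 ≤ D.E (star d * w * d)) : 0 ≤ w := by
  have hn : 0 ≤ w⁻ := CFC.negPart_nonneg w
  have hsa : IsSelfAdjoint w⁻ := IsSelfAdjoint.of_nonneg hn
  have e1 : star (w⁻) * w * w⁻ = -(w⁻ * w⁻ * w⁻) := by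
    have e0 : w⁻ * w = -(w⁻ * w⁻) := by
      calc w⁻ * w = w⁻ * (w⁺ - w⁻) := by rw [CFC.posPart_sub_negPart w hw]
        _ = -(w⁻ * w⁻) := by simp [mul_sub]
    rw [hsa.star_eq, e0, neg_mul]
  have hc : 0 ≤ w⁻ * w⁻ * w⁻ := by
    have := star_left_conjugate_nonneg hn w⁻
    rwa [hsa.star_eq] at this
  obtain ⟨c, hc'⟩ := CStarAlgebra.nonneg_iff_eq_star_mul_self.mp hc
  have h1 := h w⁻
  rw [e1, hc', map_neg, neg_nonneg] at h1
  have h2 : c = 0 := D.E_faithful c (le_antisymm h1 (D.E_star_mul_self_nonneg c))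
  rw [h2, mul_zero] at hc'
  exact (CFC.negPart_eq_zero_iff w hw).mp (eq_zero_of_mul_self_mul_self hsa hc')

lemma nonneg_of_E {w : B} (h : ∀ d, 0 ≤ D.E (star d * w * d)) : 0 ≤ w := by
  have key : ∀ d, D.E (star d * star w * d) = D.E (star d * w * d) := fun d => by
    rw [← (IsSelfAdjoint.of_nonneg (h d)).star_eq, ← D.E_star]
    simp [mul_assoc]
  set s := Complex.I • (w - star w) with hs
  have hsa : IsSelfAdjoint s := by
    rw [isSelfAdjoint_iff, hs, star_smul, star_sub, star_star]
    simp [sub_eq_add_neg, add_comm]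
  have hE : ∀ d, D.E (star d * s * d) = 0 := fun d => by
    rw [hs, mul_smul_comm, smul_mul_assoc, mul_sub, sub_mul, map_smul, map_sub, key, sub_self,
      smul_zero]
  have h1 : 0 ≤ s := D.nonneg_of_E_of_isSelfAdjoint hsa fun d => (hE d).ge
  have h2 : 0 ≤ -s := D.nonneg_of_E_of_isSelfAdjoint hsa.neg fun d => by
    rw [mul_neg, neg_mul, map_neg, hE, neg_zero]
  have h3 : s = 0 := le_antisymm (neg_nonneg.mp h2) h1
  have h4 : w = star w := sub_eq_zero.mp ((smul_eq_zero.mp h3).resolve_left Complex.I_ne_zero)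
  exact D.nonneg_of_E_of_isSelfAdjoint h4.symm h

end CrossedProduct

/-! ### The form induced by a representation and the conditional expectation -/

section Theta

variable [PartialOrder A] [StarOrderedRing A] {X : Type*} [NormedAddCommGroup X] [NormedSpace ℂ X]
  {hX : HilbMod A X} {π : A → X →L[ℂ] X}

/-- The map `b ↦ ⟨z, π(E(b)) w⟩`. -/
def theta (D : CrossedProduct S B) (hπ : IsRepOn hX π) (z w : X) : B →L[ℂ] A :=
  (hX.innerL z).comp ((ContinuousLinearMap.apply ℂ X w).comp (hπ.toCLM.comp D.E))

variable (D : CrossedProduct S B) (hπ : IsRepOn hX π)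

lemma theta_apply (z z' : X) (b : B) : theta D hπ z z' b = hX.inner z (π (D.E b) z') := rfl

lemma theta_star (z z' : X) (b : B) : theta D hπ z z' (star b) = star (theta D hπ z' z b) := by
  rw [theta_apply, theta_apply, hX.inner_conj, D.E_star, hπ.2.2.2.2.1]

lemma theta_smulA (z z' : X) (a a' : A) (b : B) :
    theta D hπ (hX.smulA z a) (hX.smulA z' a') b = star a * theta D hπ z z' b * a' := by
  rw [theta_apply, theta_apply, hπ.2.2.2.2.2, hX.inner_smulA_right, hX.inner_smulA_left]

lemma theta_sum_nonneg {κ : Type*} [Fintype κ] (z : κ → X) (b : κ → B) :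
    0 ≤ ∑ k, ∑ l, theta D hπ (z k) (z l) (star (b k) * b l) := by
  refine D.closed_induction
    (P := fun b => 0 ≤ ∑ k, ∑ l, theta D hπ (z k) (z l) (star (b k) * b l)) ?_ ?_ b
  · exact (CStarAlgebra.isClosed_nonneg (A := A)).preimage (by fun_prop)
  · intro F d
    have : ∑ k, ∑ l, theta D hπ (z k) (z l)
        (star (D.comb Subtype.val (d k)) * D.comb Subtype.val (d l)) =
        ∑ g : F, hX.inner (∑ k, π (d k g) (z k)) (∑ l, π (d l g) (z l)) := by
      simp only [theta_apply, D.E_star_comb_mul_comb Subtype.val_injective, hπ.map_sum,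
        hX.inner_sum_right, hX.inner_sum_left, hπ.inner_apply_apply]
      rw [Finset.sum_comm]
      refine (Finset.sum_congr rfl fun _ _ => Finset.sum_comm).trans ?_
      exact Finset.sum_comm
    rw [this]
    exact Finset.sum_nonneg fun g _ => hX.inner_self_nonneg _

lemma theta_sum_sub_nonneg {κ κ' : Type*} [Fintype κ] [Fintype κ'] (z : κ → X) (b : κ → B)
    (z' : κ' → X) (b' : κ' → B) :
    0 ≤ ∑ k, ∑ l, theta D hπ (z k) (z l) (star (b k) * b l) -
        ∑ k, ∑ l, theta D hπ (z k) (z' l) (star (b k) * b' l) -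
        star (∑ k, ∑ l, theta D hπ (z k) (z' l) (star (b k) * b' l)) +
        ∑ k, ∑ l, theta D hπ (z' k) (z' l) (star (b' k) * b' l) := by
  have h := theta_sum_nonneg D hπ (Sum.elim z z') (Sum.elim b fun k => -b' k)
  simp only [Fintype.sum_sum_type, Sum.elim_inl, Sum.elim_inr, star_neg, neg_mul, mul_neg,
    map_neg, Finset.sum_add_distrib, Finset.sum_neg_distrib] at h
  refine h.trans_eq ?_
  have e : star (∑ k, ∑ l, theta D hπ (z k) (z' l) (star (b k) * b' l)) =
      ∑ k, ∑ l, theta D hπ (z' k) (z l) (star (b' k) * b l) := by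
    simp only [star_sum, ← theta_star, star_mul, star_star]
    exact Finset.sum_comm
  rw [e]
  abel

end Theta

/-! ### Transforms of elements of the crossed product -/

section Transform

variable [PartialOrder A] [StarOrderedRing A] {X : Type*} [NormedAddCommGroup X] [NormedSpace ℂ X]
  {hX : HilbMod A X}

namespace EquivRep

variable (er : EquivRep S hX) (D : CrossedProduct S B)

lemma inner_symm (g : G) (x y : X) :
    hX.inner ((er.v g).symm x) ((er.v g).symm y) = (S.α g).symm (hX.inner x y) := by
  apply (S.α g).injective
  change S.α g _ = S.α g _
  rw [er.v_inner]
  simp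

lemma v_one (x : X) : er.v 1 x = x := by
  have h := er.v_mul 1 1 x
  rw [S.sigma_one_left, star_one, hX.smulA_one, er.ρ_rep.1, mul_one] at h
  exact (er.v 1).injective h

lemma v_mul_smulA (g h : G) (x : X) :
    hX.smulA (er.v g (er.v h x)) (S.σ g h) = er.ρ (S.σ g h) (er.v (g * h) x) := by
  rw [er.v_mul, ← hX.smulA_mul, Unitary.star_mul_self_of_mem (S.σ_unitary g h), hX.smulA_one]

/-- `w` has the matrix coefficients (with respect to `E`) which the multiplier with symbol
`(g, a) ↦ ⟨x, ρ(a) v(g) y⟩` assigns to `b`. -/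
def IsTransform (x y : X) (b w : B) : Prop :=
  ∀ g h, D.E (star (D.u g) * w * D.u h) =
    theta D er.ρ_rep ((er.v g).symm x) ((er.v h).symm y) (star (D.u g) * b * D.u h)

variable {D}

lemma isTransform_iota_mul_u (x y : X) (a : A) (k : G) :
    er.IsTransform D x y (D.ι a * D.u k) (D.ι (hX.inner x (er.ρ a (er.v k y))) * D.u k) := by
  classical
  intro g h
  have e (c : A) : D.E (star (D.u g) * (D.ι c * D.u k) * D.u h) =
      if g = k * h then (S.α g).symm (c * S.σ k h) else 0 := by
    rw [mul_assoc, mul_assoc, D.u_mul, ← mul_assoc (D.ι c), ← map_mul, D.E_star_u_mul_iota_mul_u]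
  rw [theta_apply, e, e]
  split_ifs with hg
  · subst hg
    apply (S.α (k * h)).injective
    change S.α (k * h) _ = S.α (k * h) _
    rw [er.v_inner, StarAlgEquiv.apply_symm_apply, ContinuousLinearEquiv.apply_symm_apply]
    have h1 := er.cov (k * h) ((S.α (k * h)).symm (a * S.σ k h))
      (er.v (k * h) ((er.v h).symm y))
    rw [StarAlgEquiv.apply_symm_apply, ContinuousLinearEquiv.symm_apply_apply] at h1
    rw [← h1, er.ρ_rep.2.1, ← er.v_mul_smulA, ContinuousLinearEquiv.apply_symm_apply,
      er.ρ_rep.2.2.2.2.2, hX.inner_smulA_right]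
  · rw [← er.ρ_rep.toCLM_apply, map_zero, _root_.zero_apply, ← hX.innerL_apply, map_zero]

variable {er}

lemma IsTransform.add {x y : X} {b b' w w' : B} (h : er.IsTransform D x y b w)
    (h' : er.IsTransform D x y b' w') : er.IsTransform D x y (b + b') (w + w') := fun g k => by
  simp only [mul_add, add_mul, map_add, h g k, h' g k]

lemma IsTransform.zero {x y : X} : er.IsTransform D x y (0 : B) 0 := fun g k => by
  simp

lemma isClosed_isTransform (x y : X) (M : B →L[ℂ] B) :
    IsClosed {b | er.IsTransform D x y b (M b)} := by
  simp only [IsTransform, Set.ofPred_forall]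
  exact isClosed_iInter fun g => isClosed_iInter fun h => isClosed_eq (by fun_prop) (by fun_prop)

lemma IsTransform.E_star_comb_mul_mul_comb {F : Type*} [Fintype F] {x y : X} {b w : B}
    (h : er.IsTransform D x y b w) (s : F → G) (c d : F → A) :
    D.E (star (D.comb s c) * w * D.comb s d) =
      ∑ k, ∑ l, theta D er.ρ_rep (hX.smulA ((er.v (s k)).symm x) (c k))
        (hX.smulA ((er.v (s l)).symm y) (d l)) (star (D.u (s k)) * b * D.u (s l)) := by
  rw [D.E_star_comb_mul_mul_comb]
  simp only [h _ _, theta_smulA]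

lemma theta_sum_diag_le {F : Type*} [Fintype F] (x : X) {s : F → G} (hs : Function.Injective s)
    (c : F → A) :
    ∑ k, ∑ l, theta D er.ρ_rep (hX.smulA ((er.v (s k)).symm x) (c k))
        (hX.smulA ((er.v (s l)).symm x) (c l)) (star (D.u (s k)) * D.u (s l)) ≤
      (‖x‖ ^ 2) • D.E (star (D.comb s c) * D.comb s c) := by
  classical
  rw [D.E_star_comb_mul_comb hs, Finset.smul_sum]
  refine Finset.sum_le_sum fun k _ => ?_
  rw [Finset.sum_eq_single k]
  · rw [theta_smulA, theta_apply, D.star_u_mul_u, ← map_one D.ι, D.E_iota, er.ρ_rep.1,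
      ContinuousLinearMap.id_apply, er.inner_symm, hX.norm_sq_eq,
      ← StarAlgEquiv.norm_map (S.α (s k)).symm]
    refine CStarAlgebra.star_left_conjugate_le_norm_smul (IsSelfAdjoint.of_nonneg ?_)
    rw [← er.inner_symm]
    exact hX.inner_self_nonneg _
  · intro l _ hl
    rw [theta_apply, D.E_star_u_mul_u, if_neg fun h => hl (hs h).symm, ← er.ρ_rep.toCLM_apply,
      map_zero, _root_.zero_apply, ← hX.innerL_apply, map_zero]
  · simp

variable {n : ℕ} {x y : X} {b w : Matrix (Fin n) (Fin n) B}

lemma IsTransform.E_add_star_le (h : ∀ i j, er.IsTransform D x y (b i j) (w i j))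
    (η ξ : Fin n → B) :
    D.E (∑ i, star (η i) * w.mulVec ξ i) + star (D.E (∑ i, star (η i) * w.mulVec ξ i)) ≤
      (‖x‖ ^ 2) • D.E (∑ i, star (η i) * η i) +
        (matNorm b ^ 2 * ‖y‖ ^ 2) • D.E (∑ i, star (ξ i) * ξ i) := by
  suffices H : ∀ ζ : Fin n ⊕ Fin n → B,
      0 ≤ (‖x‖ ^ 2) • D.E (∑ i, star (ζ (.inl i)) * ζ (.inl i)) +
        (matNorm b ^ 2 * ‖y‖ ^ 2) • D.E (∑ i, star (ζ (.inr i)) * ζ (.inr i)) -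
        (D.E (∑ i, star (ζ (.inl i)) * ∑ j, w i j * ζ (.inr j)) +
          star (D.E (∑ i, star (ζ (.inl i)) * ∑ j, w i j * ζ (.inr j)))) from
    sub_nonneg.mp (H (Sum.elim η ξ))
  refine D.closed_induction
    ((CStarAlgebra.isClosed_nonneg (A := A)).preimage (by fun_prop)) fun F d => ?_
  set s : F → G := Subtype.val with hs
  have hsi : Function.Injective s := Subtype.val_injective
  set c : Fin n → F → A := fun i => d (.inl i)
  set c' : Fin n → F → A := fun i => d (.inr i)
  set z : Fin n → F → X := fun i k => hX.smulA ((er.v (s k)).symm x) (c i k)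
  set z' : Fin n × F → X := fun p => hX.smulA ((er.v (s p.2)).symm y) (c' p.1 p.2)
  obtain ⟨e, he⟩ := exists_matrix_star_mul_self_add_eq b
  let Q (m : Matrix (Fin n) (Fin n) B) : A := ∑ i, ∑ p, ∑ q, theta D er.ρ_rep (z' p) (z' q)
    (star (m i p.1 * D.u (s p.2)) * (m i q.1 * D.u (s q.2)))
  have hQe : 0 ≤ Q e := Finset.sum_nonneg fun i _ => theta_sum_nonneg D er.ρ_rep z' _
  have hcross : D.E (∑ i, star (D.comb s (c i)) * ∑ j, w i j * D.comb s (c' j)) =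
      ∑ i, ∑ k, ∑ q, theta D er.ρ_rep (z i k) (z' q)
        (star (D.u (s k)) * (b i q.1 * D.u (s q.2))) := by
    simp only [Finset.mul_sum, map_sum, ← mul_assoc, (h _ _).E_star_comb_mul_mul_comb,
      Fintype.sum_prod_type]
    exact Finset.sum_congr rfl fun i _ => Finset.sum_comm
  have hpos := Finset.sum_nonneg fun i (_ : i ∈ Finset.univ) =>
    theta_sum_sub_nonneg D er.ρ_rep (z i) (fun k => D.u (s k)) z'
      fun q => b i q.1 * D.u (s q.2)
  rw [Finset.sum_add_distrib, Finset.sum_sub_distrib, Finset.sum_sub_distrib, ← star_sum,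
    ← hcross] at hpos
  have hP : ∑ i, ∑ k, ∑ l, theta D er.ρ_rep (z i k) (z i l) (star (D.u (s k)) * D.u (s l)) ≤
      (‖x‖ ^ 2) • D.E (∑ i, star (D.comb s (c i)) * D.comb s (c i)) := by
    rw [map_sum, Finset.smul_sum]
    exact Finset.sum_le_sum fun i _ => theta_sum_diag_le x hsi (c i)
  have hQ : Q e + Q b ≤
      (matNorm b ^ 2 * ‖y‖ ^ 2) • D.E (∑ i, star (D.comb s (c' i)) * D.comb s (c' i)) := by
    have e1 : Q e + Q b = (matNorm b ^ 2) • ∑ i, ∑ k, ∑ l,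
        theta D er.ρ_rep (z' (i, k)) (z' (i, l)) (star (D.u (s k)) * D.u (s l)) := by
      have e2 (p q : Fin n × F) :
          ∑ i, (star (e i p.1 * D.u (s p.2)) * (e i q.1 * D.u (s q.2)) +
            star (b i p.1 * D.u (s p.2)) * (b i q.1 * D.u (s q.2))) =
          if p.1 = q.1 then ((matNorm b ^ 2 : ℝ) : ℂ) • (star (D.u (s p.2)) * D.u (s q.2))
            else 0 := by
        calc _ = star (D.u (s p.2)) *
              (∑ i, (star (e i p.1) * e i q.1 + star (b i p.1) * b i q.1)) * D.u (s q.2) := by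
              simp only [Finset.mul_sum, Finset.sum_mul, star_mul, mul_add, add_mul, mul_assoc]
          _ = _ := by
              rw [he]
              split_ifs <;> simp
      calc Q e + Q b = ∑ p, ∑ q, theta D er.ρ_rep (z' p) (z' q)
            (∑ i, (star (e i p.1 * D.u (s p.2)) * (e i q.1 * D.u (s q.2)) +
            star (b i p.1 * D.u (s p.2)) * (b i q.1 * D.u (s q.2)))) := by
            simp only [Q, map_sum, map_add, Finset.sum_add_distrib]
            congr 1 <;>
            exact Finset.sum_comm.trans (Finset.sum_congr rfl fun _ _ => Finset.sum_comm)
        _ = _ := by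
            simp only [e2, Fintype.sum_prod_type, Finset.smul_sum]
            refine Finset.sum_congr rfl fun i _ => Finset.sum_congr rfl fun k _ => ?_
            rw [Finset.sum_eq_single i]
            · refine Finset.sum_congr rfl fun l _ => ?_
              rw [if_pos rfl, map_smul, Complex.coe_smul]
            · intro j _ hj
              simp [hj.symm]
            · simp
    rw [e1, mul_smul, map_sum, Finset.smul_sum (r := ‖y‖ ^ 2)]
    exact smul_le_smul_of_nonneg_left
      (Finset.sum_le_sum fun i _ => theta_sum_diag_le y hsi (c' i)) (by positivity)
  refine hpos.trans ?_
  have hQb : Q b ≤ Q e + Q b := le_add_of_nonneg_left hQe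
  have := add_le_add hP (hQb.trans hQ)
  refine le_trans (le_of_eq ?_) (sub_le_sub_right this _)
  abel

end EquivRep

end Transform

/-! ### Norm estimates and construction of the multiplier -/

section Multiplier

variable [PartialOrder A] [StarOrderedRing A] [PartialOrder B] [StarOrderedRing B] {X : Type*}
  [NormedAddCommGroup X] [NormedSpace ℂ X] {hX : HilbMod A X}

namespace EquivRep

variable {er : EquivRep S hX} {D : CrossedProduct S B} {x y : X}

lemma IsTransform.sum_star_mul_mulVec_le {n : ℕ} {b w : Matrix (Fin n) (Fin n) B}
    (h : ∀ i j, er.IsTransform D x y (b i j) (w i j)) {r : ℝ} (hr : 0 < r) (hxr : ‖x‖ ^ 2 ≤ r)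
    (ξ : Fin n → B) :
    ∑ i, star (w.mulVec ξ i) * w.mulVec ξ i ≤
      (r * (matNorm b ^ 2 * ‖y‖ ^ 2)) • ∑ i, star (ξ i) * ξ i := by
  rw [← sub_nonneg]
  refine D.nonneg_of_E fun d => ?_
  set ω : Fin n → B := fun i => w.mulVec ξ i * d with hω
  set ξ' : Fin n → B := fun i => ξ i * d with hξ'
  have hωξ : w.mulVec ξ' = ω := by
    ext i
    simp only [hω, hξ', Matrix.mulVec, dotProduct, Finset.sum_mul, mul_assoc]
  set P := D.E (∑ i, star (ω i) * ω i)
  set Q := D.E (∑ i, star (ξ' i) * ξ' i)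
  have hP : 0 ≤ P := by
    simp only [P, map_sum]
    exact Finset.sum_nonneg fun i _ => D.E_star_mul_self_nonneg _
  have e : D.E (star d * ((r * (matNorm b ^ 2 * ‖y‖ ^ 2)) • ∑ i, star (ξ i) * ξ i -
      ∑ i, star (w.mulVec ξ i) * w.mulVec ξ i) * d) =
      r • (matNorm b ^ 2 * ‖y‖ ^ 2) • Q - P := by
    rw [mul_sub, sub_mul, map_sub, mul_smul_comm, smul_mul_assoc, D.E.map_smul_of_tower, mul_smul]
    simp only [P, Q, hω, hξ', Finset.mul_sum, Finset.sum_mul, star_mul, mul_assoc]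
  have key := IsTransform.E_add_star_le h (fun i => r⁻¹ • ω i) ξ'
  have e1 : D.E (∑ i, star (r⁻¹ • ω i) * w.mulVec ξ' i) = r⁻¹ • P := by
    simp only [hωξ, P, star_smul, star_trivial, smul_mul_assoc, ← Finset.smul_sum,
      D.E.map_smul_of_tower]
  have e2 : D.E (∑ i, star (r⁻¹ • ω i) * (r⁻¹ • ω i)) = r⁻¹ • r⁻¹ • P := by
    simp only [P, star_smul, star_trivial, smul_mul_assoc, mul_smul_comm, ← Finset.smul_sum,
      D.E.map_smul_of_tower]
  simp only [e1, e2] at key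
  rw [star_smul, star_trivial, (IsSelfAdjoint.of_nonneg hP).star_eq] at key
  have h1 : (‖x‖ ^ 2) • r⁻¹ • r⁻¹ • P ≤ r⁻¹ • P := by
    rw [smul_smul]
    refine smul_le_of_le_one_left (smul_nonneg (inv_nonneg.mpr hr.le) hP) ?_
    rwa [← div_eq_mul_inv, div_le_one hr]
  have h2 : r⁻¹ • P ≤ (matNorm b ^ 2 * ‖y‖ ^ 2) • Q :=
    le_of_add_le_add_left (key.trans (by gcongr))
  rw [e, sub_nonneg]
  simpa [smul_smul, hr.ne'] using smul_le_smul_of_nonneg_left h2 hr.le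

lemma IsTransform.matNorm_le {n : ℕ} {b w : Matrix (Fin n) (Fin n) B}
    (h : ∀ i j, er.IsTransform D x y (b i j) (w i j)) :
    matNorm w ≤ ‖x‖ * ‖y‖ * matNorm b := by
  have hb := matNorm_nonneg b
  refine BCFourier.matNorm_le (by positivity) fun ξ => ?_
  have hξ := vecNorm_nonneg ξ
  refine le_of_sq_le_sq ?_ (by positivity)
  have H : ∀ r, ‖x‖ ^ 2 < r → vecNorm (w.mulVec ξ) ^ 2 ≤
      r * (matNorm b ^ 2 * ‖y‖ ^ 2) * vecNorm ξ ^ 2 := fun r hr => by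
    have hr0 : 0 < r := (sq_nonneg _).trans_lt hr
    have := CStarAlgebra.norm_le_norm_of_nonneg_of_le (norm_sum_star_mul_self_nonneg _)
      (sum_star_mul_mulVec_le h hr0 hr.le ξ)
    rwa [norm_smul, Real.norm_of_nonneg (by positivity), ← vecNorm_sq, ← vecNorm_sq] at this
  have hlim : Filter.Tendsto (fun r : ℝ => r * (matNorm b ^ 2 * ‖y‖ ^ 2) * vecNorm ξ ^ 2)
      (nhdsWithin (‖x‖ ^ 2) (Set.Ioi (‖x‖ ^ 2)))
      (nhds (‖x‖ ^ 2 * (matNorm b ^ 2 * ‖y‖ ^ 2) * vecNorm ξ ^ 2)) :=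
    (Continuous.tendsto (by fun_prop) _).mono_left nhdsWithin_le_nhds
  refine (ge_of_tendsto hlim (eventually_nhdsWithin_of_forall H)).trans_eq ?_
  ring

lemma IsTransform.norm_le {b w : B} (h : er.IsTransform D x y b w) : ‖w‖ ≤ ‖x‖ * ‖y‖ * ‖b‖ := by
  have := IsTransform.matNorm_le (b := !![b]) (w := !![w]) (D := D) (er := er) (x := x) (y := y)
    fun i j => by simpa [Fin.fin_one_eq_zero] using h
  rwa [matNorm_singleton, matNorm_singleton] at this

variable (er D x y)

lemma exists_multiplier :
    ∃ M : B →L[ℂ] B, IsMultiplier D (fun g a => hX.inner x (er.ρ a (er.v g y))) M ∧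
      ∀ b, er.IsTransform D x y b (M b) := by
  have hT (g : G) : IsLinearMap ℂ fun a => hX.inner x (er.ρ a (er.v g y)) :=
    ⟨fun a b => by rw [er.ρ_rep.2.2.1, _root_.add_apply, hX.inner_add_right],
      fun c a => by rw [er.ρ_rep.2.2.2.1, _root_.smul_apply, hX.inner_smul_right]⟩
  let e : (G →₀ A) →ₗ[ℂ] B := Finsupp.lsum ℂ fun g =>
    (LinearMap.mulRight ℂ (D.u g)).comp D.ι.toAlgHom.toLinearMap
  let f : (G →₀ A) →ₗ[ℂ] B := Finsupp.lsum ℂ fun g =>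
    ((LinearMap.mulRight ℂ (D.u g)).comp D.ι.toAlgHom.toLinearMap).comp (hT g).mk'
  have he (g : G) (a : A) : e (Finsupp.single g a) = D.ι a * D.u g := by simp [e]
  have hf (g : G) (a : A) :
      f (Finsupp.single g a) = D.ι (hX.inner x (er.ρ a (er.v g y))) * D.u g :=
    Finsupp.sum_single_index (map_zero _)
  have hef (p : G →₀ A) : er.IsTransform D x y (e p) (f p) := by
    induction p using Finsupp.induction_linear with
    | zero => simpa using IsTransform.zero
    | add p q hp hq => simpa using hp.add hq
    | single g a => simpa only [he, hf] using er.isTransform_iota_mul_u x y a g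
  have hd : DenseRange e := by
    refine D.generated.mono ?_
    change _ ⊆ ((LinearMap.range e : Submodule ℂ B) : Set B)
    rw [SetLike.coe_subset_coe, Submodule.span_le]
    rintro _ ⟨a, g, rfl⟩
    exact ⟨Finsupp.single g a, he g a⟩
  have hM (p : G →₀ A) : f.extendOfNorm e (e p) = f p :=
    LinearMap.extendOfNorm_eq hd ⟨‖x‖ * ‖y‖, fun p => (hef p).norm_le⟩ p
  refine ⟨f.extendOfNorm e, ⟨hT, fun g a => by rw [← he, hM, hf]⟩, fun b => ?_⟩
  refine hd.induction_on (p := fun b => er.IsTransform D x y b (f.extendOfNorm e b)) b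
    (isClosed_isTransform x y _) fun p => ?_
  rw [hM]
  exact hef p

variable {er D x y}

lemma isCompletelyPositive_of_isTransform {M : B → B} (h : ∀ b, er.IsTransform D x x b (M b)) :
    IsCompletelyPositive M := by
  intro n b c
  refine D.nonneg_of_E fun d => ?_
  have e : D.E (star d * (∑ i, ∑ j, star (c i) * M (star (b i) * b j) * c j) * d) =
      ∑ i, ∑ j, D.E (star (c i * d) * M (star (b i) * b j) * (c j * d)) := by
    simp only [Finset.mul_sum, Finset.sum_mul, map_sum, star_mul, mul_assoc]
  rw [e]
  refine D.closed_induction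
    (P := fun ξ : Fin n → B => 0 ≤ ∑ i, ∑ j, D.E (star (ξ i) * M (star (b i) * b j) * ξ j))
    ((CStarAlgebra.isClosed_nonneg (A := A)).preimage (by fun_prop)) (fun F ξ => ?_) _
  refine (theta_sum_nonneg D er.ρ_rep
    (fun p : Fin n × F => hX.smulA ((er.v p.2).symm x) (ξ p.1 p.2))
    fun p => b p.1 * D.u p.2).trans_eq ?_
  simp only [(h _).E_star_comb_mul_mul_comb, Fintype.sum_prod_type]
  simp only [star_mul, mul_assoc]
  exact Finset.sum_congr rfl fun i _ => Finset.sum_comm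

end EquivRep

end Multiplier

lemma norm_le_cbNorm (M : B →L[ℂ] B) {K : ℝ} (hK : CBBoundedBy M K) : ‖M‖ ≤ cbNorm M := by
  refine le_csInf ⟨K, hK⟩ fun L hL => M.opNorm_le_bound hL.1 fun b => ?_
  have := hL.2 1 !![b]
  rwa [matNorm_singleton, show (!![b] : Matrix _ _ B).map M = !![M b] by ext i j; simp,
    matNorm_singleton] at this

lemma cbNorm_le {φ : B → B} {K : ℝ} (hK : CBBoundedBy φ K) : cbNorm φ ≤ K :=
  csInf_le ⟨0, fun _ h => h.1⟩ hK

/-- Theorem `Phi-thm`. For an equivariant representation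
`(ρ, v)` of `Σ` on a Hilbert `A`-module `X` and `x, y ∈ X`, the map
`T(g,a) = ⟨x, ρ(a) v(g) y⟩` is a cb-multiplier of `Σ` with
`‖M_T‖ ≤ ‖M_T‖_cb ≤ ‖x‖ ‖y‖`; if `x = y`, then `M_T` is completely positive
and `‖M_T‖ = ‖M_T‖_cb = ‖x‖²`. -/
theorem statement8 {A G B : Type*} [CStarAlgebra A] [PartialOrder A] [StarOrderedRing A]
    [Group G] [CStarAlgebra B] [PartialOrder B] [StarOrderedRing B]
    (S : TwistedSystem A G) (D : CrossedProduct S B)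
    {X : Type*} [NormedAddCommGroup X] [NormedSpace ℂ X] [CompleteSpace X]
    (hX : HilbMod A X) (er : EquivRep S hX) (x y : X) :
    ∃ M : B →L[ℂ] B,
      IsMultiplier D (fun g a => hX.inner x (er.ρ a (er.v g y))) M ∧
      ‖M‖ ≤ cbNorm (⇑M) ∧
      CBBoundedBy (⇑M) (‖x‖ * ‖y‖) ∧ cbNorm (⇑M) ≤ ‖x‖ * ‖y‖ ∧
      (x = y → IsCompletelyPositive (⇑M) ∧ ‖M‖ = ‖x‖ ^ 2 ∧ cbNorm (⇑M) = ‖x‖ ^ 2) := by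
  obtain ⟨M, hM, hT⟩ := er.exists_multiplier D x y
  have hcb : CBBoundedBy M (‖x‖ * ‖y‖) :=
    ⟨by positivity, fun n m => EquivRep.IsTransform.matNorm_le fun i j => hT (m i j)⟩
  have hle := norm_le_cbNorm M hcb
  refine ⟨M, hM, hle, hcb, cbNorm_le hcb, ?_⟩
  rintro rfl
  have hcb' : cbNorm M ≤ ‖x‖ ^ 2 := (cbNorm_le hcb).trans_eq (sq _).symm
  have hge : ‖x‖ ^ 2 ≤ ‖M‖ := by
    have h1 := hM.2 1 1
    beta_reduce at h1
    rw [map_one, D.u_one, mul_one, mul_one, er.ρ_rep.1, ContinuousLinearMap.id_apply,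
      er.v_one] at h1
    rw [hX.norm_sq_eq, ← D.ι_isometric, ← h1]
    exact M.unit_le_opNorm 1 norm_one_le_one
  exact ⟨EquivRep.isCompletelyPositive_of_isTransform hT, (hle.trans hcb').antisymm hge,
    hcb'.antisymm (hge.trans hle)⟩

end BCFourier
end
end
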